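/- Let n ≥ 0, let α ∈ ℝ with −1 ≤ α ≤ n, and let β_0, …, β_n ∈ [−1, 0] with β_0 + ⋯ + β_n = α − n. If f ∈ T^α(ℝ), then the divided difference f^{[n]} belongs to S^{β_0}(ℝ) ⊠_i ⋯ ⊠_i S^{β_n}(ℝ), and for all integers k_0, …, k_n ≥ 0 there is a constant C, depending only on n, α, the β_j and the k_j (not on f), such that ‖f^{[n]}‖_{k_0,…,k_n} ≤ C · Σ_{r=0}^{n + k_0 + ⋯ + k_n + 2} ‖f‖_{T^α,r}. -/

import Mathlib

open MeasureTheory Filter Topology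
open scoped ENNReal NNReal

noncomputable section

/-- The Japanese bracket `⟨x⟩ = (1 + x²)^(1/2)`. -/
def jb (x : ℝ) : ℝ := Real.sqrt (1 + x ^ 2)

/-- The weight `‖f⁽ᵏ⁾(x)‖ ⟨x⟩^(k−β)` defining the `S^β` seminorms. -/
def sWeight (β : ℝ) (k : ℕ) (f : ℝ → ℂ) (x : ℝ) : ℝ :=
  ‖iteratedDeriv k f x‖ * jb x ^ ((k : ℝ) - β)

/-- The `S^β` seminorm `‖f‖_{S^β,k} = sup_x ‖f⁽ᵏ⁾(x)‖ ⟨x⟩^(k−β)`. -/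
def SNorm (β : ℝ) (k : ℕ) (f : ℝ → ℂ) : ℝ := ⨆ x : ℝ, sWeight β k f x

/-- Membership in `S^β(ℝ)`: smooth with all the seminorms finite. -/
def MemS (β : ℝ) (f : ℝ → ℂ) : Prop :=
  ContDiff ℝ (⊤ : ℕ∞) f ∧ ∀ k : ℕ, BddAbove (Set.range (sWeight β k f))

/-- The weight `‖f⁽ᵏ⁾(x)‖ ⟨x⟩^(k−β−1)` defining the `T^β` seminorms. -/
def tWeight (β : ℝ) (k : ℕ) (f : ℝ → ℂ) (x : ℝ) : ℝ :=
  ‖iteratedDeriv k f x‖ * jb x ^ ((k : ℝ) - β - 1)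

/-- The `T^β` seminorm `‖f‖_{T^β,k} = ∫ ‖f⁽ᵏ⁾(x)‖ ⟨x⟩^(k−β−1) dx`. -/
def TNorm (β : ℝ) (k : ℕ) (f : ℝ → ℂ) : ℝ := ∫ x : ℝ, tWeight β k f x

/-- Membership in `T^β(ℝ)`: smooth with all the seminorms finite. -/
def MemT (β : ℝ) (f : ℝ → ℂ) : Prop :=
  ContDiff ℝ (⊤ : ℕ∞) f ∧ ∀ k : ℕ, Integrable (tWeight β k f)

/-- `F` is the sequence of divided differences of `f`: `F 0 = f`, each `F m` is
continuous, and the divided-difference recursion holds off the diagonal. -/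
def IsDivDiff (f : ℝ → ℂ) (F : (m : ℕ) → (Fin (m + 1) → ℝ) → ℂ) : Prop :=
  (∀ x : Fin 1 → ℝ, F 0 x = f (x 0)) ∧
  (∀ m, Continuous (F m)) ∧
  (∀ m, ∀ x : Fin (m + 2) → ℝ, x 0 ≠ x (Fin.last (m + 1)) →
    F (m + 1) x = (F m (fun i => x i.succ) - F m (fun i => x i.castSucc)) /
      ((x 0 - x (Fin.last (m + 1)) : ℝ) : ℂ))

end
noncomputable section

open MeasureTheory
open scoped ENNReal

/-- `(Ω, mΩ, ν, a)` is an admissible integral representation of the symbol `φ`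
witnessing membership in `S^{β 0}(ℝ) ⊠ᵢ ⋯ ⊠ᵢ S^{β n}(ℝ)`. -/
def IsBoxRep {n : ℕ} (β : Fin (n + 1) → ℝ) (φ : (Fin (n + 1) → ℝ) → ℂ)
    (Ω : Type) (mΩ : MeasurableSpace Ω) (ν : @Measure Ω mΩ)
    (a : Fin (n + 1) → ℝ → Ω → ℂ) : Prop :=
  SigmaFinite ν ∧
  (∀ j, Measurable (Function.uncurry (a j))) ∧
  (∀ j ω, MemS (β j) (fun x => a j x ω)) ∧
  (∀ j k, Measurable fun ω => SNorm (β j) k (fun x => a j x ω)) ∧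
  (∀ lam : Fin (n + 1) → ℝ, φ lam = ∫ ω, ∏ j, a j (lam j) ω ∂ν) ∧
  (∀ k : Fin (n + 1) → ℕ,
    Integrable (fun ω => ∏ j, SNorm (β j) (k j) (fun x => a j x ω)) ν)

/-- Membership of `φ` in `S^{β 0}(ℝ) ⊠ᵢ ⋯ ⊠ᵢ S^{β n}(ℝ)`. -/
def MemBox {n : ℕ} (β : Fin (n + 1) → ℝ) (φ : (Fin (n + 1) → ℝ) → ℂ) : Prop :=
  ∃ (Ω : Type) (mΩ : MeasurableSpace Ω) (ν : @Measure Ω mΩ)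
    (a : Fin (n + 1) → ℝ → Ω → ℂ), IsBoxRep β φ Ω mΩ ν a

/-- The seminorm `‖φ‖_{k_0,…,k_n}` of `S^{β 0}(ℝ) ⊠ᵢ ⋯ ⊠ᵢ S^{β n}(ℝ)`: the infimum,
over all admissible representations, of `∫ ∏_j ‖a_j(·,ω)‖_{S^{β_j},k_j} dν(ω)`. -/
def boxNorm {n : ℕ} (β : Fin (n + 1) → ℝ) (k : Fin (n + 1) → ℕ)
    (φ : (Fin (n + 1) → ℝ) → ℂ) : ℝ≥0∞ :=
  sInf { M : ℝ≥0∞ | ∃ (Ω : Type) (mΩ : MeasurableSpace Ω) (ν : @Measure Ω mΩ)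
    (a : Fin (n + 1) → ℝ → Ω → ℂ), IsBoxRep β φ Ω mΩ ν a ∧
    M = ∫⁻ ω, ∏ j, ENNReal.ofReal (SNorm (β j) (k j) (fun x => a j x ω)) ∂ν }

end

noncomputable section

open MeasureTheory Filter Topology
open scoped ENNReal NNReal

lemma jb_pos (x : ℝ) : 0 < jb x := Real.sqrt_pos.2 (by positivity)

lemma one_le_jb (x : ℝ) : 1 ≤ jb x := Real.one_le_sqrt.2 (by nlinarith [sq_nonneg x])

lemma jb_sq (x : ℝ) : jb x ^ 2 = 1 + x ^ 2 := Real.sq_sqrt (by positivity)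

lemma abs_le_jb (x : ℝ) : |x| ≤ jb x := Real.abs_le_sqrt (by linarith)

lemma hasDerivAt_jb (x : ℝ) : HasDerivAt jb (x / jb x) x := by
  have h : HasDerivAt (fun y : ℝ => 1 + y ^ 2) (2 * x) x := by
    simpa using (hasDerivAt_pow 2 x).const_add 1
  have h2 := h.sqrt (by positivity)
  rwa [mul_div_mul_left _ _ two_ne_zero] at h2

lemma continuous_jb : Continuous jb :=
  continuous_iff_continuousAt.2 fun x => (hasDerivAt_jb x).continuousAt

lemma abs_div_jb_le (x : ℝ) : |x / jb x| ≤ 1 := by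
  rw [abs_div, abs_of_pos (jb_pos x)]
  exact div_le_one_of_le₀ (abs_le_jb x) (jb_pos x).le

/-- The Japanese bracket is `1`-Lipschitz. -/
lemma jb_le_add (x y : ℝ) : jb y ≤ jb x + |y - x| := by
  refine abs_le_of_sq_le_sq' ?_ (add_nonneg (jb_pos x).le (abs_nonneg _)) |>.2
  have h1 : (y - x) * x ≤ |y - x| * jb x :=
    (le_abs_self _).trans (by rw [abs_mul]; gcongr; exact abs_le_jb x)
  nlinarith [jb_sq x, jb_sq y, sq_abs (y - x)]

/-- The point `x + i t ⟨x⟩`. -/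
def zpt (x t : ℝ) : ℂ := (x : ℂ) + (t * jb x : ℝ) * Complex.I

lemma zpt_sub_re (x t l : ℝ) : (zpt x t - l).re = x - l := by simp [zpt]

lemma zpt_sub_im (x t l : ℝ) : (zpt x t - l).im = t * jb x := by simp [zpt]

lemma abs_sub_le_norm_zpt (x t l : ℝ) : |x - l| ≤ ‖zpt x t - l‖ := by
  rw [← zpt_sub_re x t l]
  exact Complex.abs_re_le_norm _

lemma mul_jb_le_norm_zpt (x t l : ℝ) : |t| * jb x ≤ ‖zpt x t - l‖ := by
  rw [← abs_of_pos (jb_pos x), ← abs_mul, ← zpt_sub_im x t l]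
  exact Complex.abs_im_le_norm _

lemma zpt_sub_ne_zero {t : ℝ} (ht : t ≠ 0) (x l : ℝ) : zpt x t - l ≠ 0 :=
  norm_pos_iff.1 ((mul_pos (abs_pos.2 ht) (jb_pos x)).trans_le (mul_jb_le_norm_zpt x t l))

lemma norm_inv_zpt_sub_le {t : ℝ} (ht : t ≠ 0) (x l : ℝ) :
    ‖(zpt x t - l)⁻¹‖ ≤ |t|⁻¹ * (jb x)⁻¹ := by
  rw [norm_inv, ← mul_inv]
  exact inv_anti₀ (mul_pos (abs_pos.2 ht) (jb_pos x)) (mul_jb_le_norm_zpt x t l)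

lemma continuous_zpt : Continuous (fun p : ℝ × ℝ => zpt p.1 p.2) := by
  have := continuous_jb
  unfold zpt
  fun_prop

/-- The symbol `∏ⱼ (z - λⱼ)⁻¹` of a product of resolvents. -/
def resProd {ι : Type*} [Fintype ι] (lam : ι → ℝ) (z : ℂ) : ℂ := ∏ j, (z - lam j)⁻¹

lemma measurable_resProd {ι : Type*} [Fintype ι] (lam : ι → ℝ) : Measurable (resProd lam) := by
  unfold resProd
  fun_prop

lemma norm_resProd_le {n : ℕ} (lam : Fin (n + 1) → ℝ) {t : ℝ} (ht : t ≠ 0) (x : ℝ) :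
    ‖resProd lam (zpt x t)‖ ≤ (|t|⁻¹) ^ (n + 1) * ((jb x)⁻¹) ^ (n + 1) := by
  rw [resProd, norm_prod, ← mul_pow]
  calc _ ≤ ∏ _j : Fin (n + 1), (|t|⁻¹ * (jb x)⁻¹) :=
        Finset.prod_le_prod (fun _ _ => norm_nonneg _) fun j _ => norm_inv_zpt_sub_le ht x (lam j)
    _ = _ := by simp

lemma iteratedDeriv_resolvent (c z : ℂ) (hz : z.im ≠ 0) (k : ℕ) :
    iteratedDeriv k (fun l : ℝ => c * (z - l)⁻¹) =
      fun l : ℝ => c * (k.factorial * ((z - l)⁻¹) ^ (k + 1)) := by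
  have hne : ∀ l : ℝ, z - l ≠ 0 := fun l h => hz (by simpa using congrArg Complex.im h)
  induction k with
  | zero => simp
  | succ k ih =>
    rw [iteratedDeriv_succ, ih]
    funext l
    have h1 : HasDerivAt (fun l : ℝ => z - (l : ℂ)) (-1) l := by
      simpa using (Complex.ofRealCLM.hasDerivAt (x := l)).const_sub z
    have h2 := (((h1.fun_inv (hne l)).fun_pow (k + 1)).const_mul (k.factorial : ℂ)).const_mul c
    rw [h2.deriv]
    push_cast [Nat.factorial_succ]
    rw [neg_neg, one_div, ← inv_pow]
    ring

lemma contDiff_resolvent (c z : ℂ) (hz : z.im ≠ 0) :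
    ContDiff ℝ (⊤ : ℕ∞) (fun l : ℝ => c * (z - l)⁻¹) := by
  have hne : ∀ l : ℝ, z - l ≠ 0 := fun l h => hz (by simpa using congrArg Complex.im h)
  exact contDiff_const.mul ((contDiff_const.sub Complex.ofRealCLM.contDiff).inv hne)

lemma sWeight_resolvent_le {b : ℝ} (hb : -1 ≤ b) (hb' : b ≤ 0) (k : ℕ) (c : ℂ) {t : ℝ}
    (ht : t ≠ 0) (ht1 : |t| ≤ 1) (x l : ℝ) :
    sWeight b k (fun l : ℝ => c * (zpt x t - l)⁻¹) l ≤
      ‖c‖ * (k.factorial * 2 ^ (k + 1)) * ((|t|⁻¹) ^ (k + 1) * jb x ^ (-1 - b)) := by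
  have hz : (zpt x t).im ≠ 0 := by
    have := zpt_sub_im x t 0
    simp only [Complex.ofReal_zero, sub_zero] at this
    rw [this]; exact mul_ne_zero ht (jb_pos x).ne'
  have ht0 : 0 < |t| := abs_pos.2 ht
  have hN : 0 < ‖zpt x t - l‖ := norm_pos_iff.2 (zpt_sub_ne_zero ht x l)
  set N := ‖zpt x t - l‖ with hNdef
  have h1 : |t| * jb x ≤ N := mul_jb_le_norm_zpt x t l
  have h2 : jb l ≤ 2 * |t|⁻¹ * N := by
    have h3 := jb_le_add x l
    have h4 : |l - x| ≤ N := by rw [abs_sub_comm]; exact abs_sub_le_norm_zpt x t l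
    have h5 : jb x ≤ |t|⁻¹ * N := by rw [inv_mul_eq_div, le_div_iff₀ ht0]; linarith
    have h6 : N ≤ |t|⁻¹ * N := le_mul_of_one_le_left hN.le ((one_le_inv₀ ht0).2 ht1)
    linarith
  rw [sWeight, iteratedDeriv_resolvent _ _ hz]
  simp only [norm_mul, norm_pow, norm_inv, ← hNdef, Complex.norm_natCast]
  have e1 : (0:ℝ) ≤ (k : ℝ) - b := by have : (0:ℝ) ≤ k := k.cast_nonneg; linarith
  have h7 : jb l ^ ((k : ℝ) - b) ≤ (2 * |t|⁻¹) ^ ((k : ℝ) - b) * N ^ ((k : ℝ) - b) := by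
    rw [← Real.mul_rpow (by positivity) hN.le]
    exact Real.rpow_le_rpow (jb_pos l).le h2 e1
  have h8 : (2 * |t|⁻¹) ^ ((k : ℝ) - b) =
      2 ^ ((k : ℝ) - b) * ((|t|⁻¹) ^ (k + 1) * |t| ^ (1 + b)) := by
    rw [Real.mul_rpow (by norm_num) (by positivity), ← Real.rpow_natCast (|t|⁻¹),
      Real.inv_rpow ht0.le, Real.inv_rpow ht0.le, ← Real.rpow_neg ht0.le, ← Real.rpow_neg ht0.le,
      ← Real.rpow_add ht0]
    congr 2; push_cast; ring
  have h9 : (2:ℝ) ^ ((k : ℝ) - b) ≤ 2 ^ (k + 1) := by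
    rw [← Real.rpow_natCast]
    exact Real.rpow_le_rpow_of_exponent_le (by norm_num) (by push_cast; linarith)
  have h10 : (N⁻¹) ^ (k + 1) * N ^ ((k : ℝ) - b) = N ^ (-1 - b) := by
    rw [← Real.rpow_natCast, Real.inv_rpow hN.le, ← Real.rpow_neg hN.le, ← Real.rpow_add hN]
    congr 1; push_cast; ring
  have h11 : |t| ^ (1 + b) * N ^ (-1 - b) ≤ jb x ^ (-1 - b) := by
    calc |t| ^ (1 + b) * N ^ (-1 - b) ≤ |t| ^ (1 + b) * (|t| * jb x) ^ (-1 - b) := by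
          refine mul_le_mul_of_nonneg_left ?_ (by positivity)
          exact Real.rpow_le_rpow_of_nonpos (mul_pos ht0 (jb_pos x)) h1 (by linarith)
      _ = jb x ^ (-1 - b) := by
          rw [Real.mul_rpow ht0.le (jb_pos x).le, ← mul_assoc, ← Real.rpow_add ht0]
          simp [show 1 + b + (-1 - b) = 0 by ring]
  have hj := jb_pos x
  calc _ ≤ ‖c‖ * (k.factorial * (N⁻¹) ^ (k + 1)) *
        ((2 * |t|⁻¹) ^ ((k : ℝ) - b) * N ^ ((k : ℝ) - b)) := by gcongr
    _ = ‖c‖ * (k.factorial * 2 ^ ((k : ℝ) - b)) * ((|t|⁻¹) ^ (k + 1) * (|t| ^ (1 + b) *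
        ((N⁻¹) ^ (k + 1) * N ^ ((k : ℝ) - b)))) := by rw [h8]; ring
    _ ≤ _ := by rw [h10]; gcongr

lemma memS_resolvent {b : ℝ} (hb : -1 ≤ b) (hb' : b ≤ 0) (c : ℂ) {t : ℝ}
    (ht : t ≠ 0) (ht1 : |t| ≤ 1) (x : ℝ) : MemS b (fun l : ℝ => c * (zpt x t - l)⁻¹) := by
  refine ⟨contDiff_resolvent _ _ ?_, fun k =>
    ⟨‖c‖ * (k.factorial * 2 ^ (k + 1)) * ((|t|⁻¹) ^ (k + 1) * jb x ^ (-1 - b)), ?_⟩⟩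
  · have := zpt_sub_im x t 0
    simp only [Complex.ofReal_zero, sub_zero] at this
    rw [this]; exact mul_ne_zero ht (jb_pos x).ne'
  · rintro _ ⟨l, rfl⟩
    exact sWeight_resolvent_le hb hb' k c ht ht1 x l

lemma SNorm_nonneg (b : ℝ) (k : ℕ) (f : ℝ → ℂ) : 0 ≤ SNorm b k f :=
  Real.iSup_nonneg fun x => mul_nonneg (norm_nonneg _) (Real.rpow_nonneg (jb_pos x).le _)

lemma SNorm_resolvent_le {b : ℝ} (hb : -1 ≤ b) (hb' : b ≤ 0) (k : ℕ) (c : ℂ) {t : ℝ}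
    (ht : t ≠ 0) (ht1 : |t| ≤ 1) (x : ℝ) :
    SNorm b k (fun l : ℝ => c * (zpt x t - l)⁻¹) ≤
      ‖c‖ * (k.factorial * 2 ^ (k + 1)) * ((|t|⁻¹) ^ (k + 1) * jb x ^ (-1 - b)) :=
  ciSup_le fun l => sWeight_resolvent_le hb hb' k c ht ht1 x l

lemma continuous_sWeight {b : ℝ} {f : ℝ → ℂ} (hf : ContDiff ℝ (⊤ : ℕ∞) f) (k : ℕ) :
    Continuous (sWeight b k f) := by
  have h1 : Continuous (iteratedDeriv k f) :=
    hf.continuous_iteratedDeriv k (by exact_mod_cast le_top)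
  exact h1.norm.mul (continuous_jb.rpow_const fun x => Or.inl (jb_pos x).ne')

/-- For a smooth symbol the seminorm is a supremum over the rationals. -/
lemma SNorm_eq_iSup_rat {b : ℝ} {f : ℝ → ℂ} (hf : MemS b f) (k : ℕ) :
    SNorm b k f = ⨆ q : ℚ, sWeight b k f q := by
  have hc := continuous_sWeight (b := b) hf.1 k
  have hb := hf.2 k
  have hb2 : BddAbove (Set.range fun q : ℚ => sWeight b k f q) :=
    hb.mono (by rintro _ ⟨q, rfl⟩; exact ⟨_, rfl⟩)
  refine le_antisymm (ciSup_le fun x => ?_) (ciSup_le fun q => le_ciSup hb (q : ℝ))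
  have : IsClosed {x : ℝ | sWeight b k f x ≤ ⨆ q : ℚ, sWeight b k f q} :=
    isClosed_le hc continuous_const
  have h2 : closure (Set.range ((↑) : ℚ → ℝ)) ⊆ _ :=
    closure_minimal (by rintro _ ⟨q, rfl⟩; exact le_ciSup hb2 q) this
  exact h2 (Rat.denseRange_cast x)

/-- The factors of a product of resolvents with a scalar coefficient put into the first one. -/
def resFactor {n : ℕ} {Ω : Type} (c : Ω → ℂ) (X τ : Ω → ℝ) (j : Fin (n + 1)) (l : ℝ) (ω : Ω) : ℂ :=
  (if j = 0 then c ω else 1) * (zpt (X ω) (τ ω) - l)⁻¹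

lemma prod_SNorm_resFactor_le {n : ℕ} {α : ℝ} {β : Fin (n + 1) → ℝ}
    (hβ : ∀ j, -1 ≤ β j ∧ β j ≤ 0) (hsum : ∑ j, β j = α - n) {Ω : Type} {c : Ω → ℂ}
    {X τ : Ω → ℝ} (hτ0 : ∀ ω, τ ω ≠ 0) (hτ1 : ∀ ω, |τ ω| ≤ 1) (k : Fin (n + 1) → ℕ) (ω : Ω) :
    ∏ j, SNorm (β j) (k j) (fun x => resFactor c X τ j x ω) ≤
      (∏ j, ((k j).factorial * 2 ^ (k j + 1) : ℝ)) *
        (‖c ω‖ * ((|τ ω|⁻¹) ^ ((∑ j, k j) + n + 1) * jb (X ω) ^ (-1 - α))) := by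
  calc _ ≤ ∏ j, (‖if j = 0 then c ω else 1‖ * ((k j).factorial * 2 ^ (k j + 1)) *
        ((|τ ω|⁻¹) ^ (k j + 1) * jb (X ω) ^ (-1 - β j))) :=
        Finset.prod_le_prod (fun j _ => SNorm_nonneg _ _ _) fun j _ =>
          SNorm_resolvent_le (hβ j).1 (hβ j).2 (k j) _ (hτ0 ω) (hτ1 ω) (X ω)
    _ = _ := by
      rw [Finset.prod_mul_distrib, Finset.prod_mul_distrib, Finset.prod_mul_distrib (g := fun j =>
        jb (X ω) ^ (-1 - β j)), Finset.prod_pow_eq_pow_sum,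
        ← Real.rpow_sum_of_pos (jb_pos _), Finset.sum_sub_distrib, hsum]
      have h1 : ∏ j : Fin (n + 1), ‖if j = 0 then c ω else 1‖ = ‖c ω‖ := by
        rw [Fin.prod_univ_succ]; simp
      have h2 : ∑ _j : Fin (n + 1), (-1 : ℝ) - (α - n) = -1 - α := by
        simp
        ring
      rw [h1, h2, Finset.sum_add_distrib]
      simp only [Finset.sum_const, Finset.card_univ, Fintype.card_fin, smul_eq_mul, mul_one,
        add_assoc]
      ring

lemma measurable_SNorm_resFactor {n : ℕ} {b : ℝ} (hb : -1 ≤ b ∧ b ≤ 0) {Ω : Type}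
    [MeasurableSpace Ω] {c : Ω → ℂ} {X τ : Ω → ℝ} (hc : Measurable c) (hX : Measurable X)
    (hτ : Measurable τ) (hτ0 : ∀ ω, τ ω ≠ 0) (hτ1 : ∀ ω, |τ ω| ≤ 1) (j : Fin (n + 1)) (k : ℕ) :
    Measurable fun ω => SNorm b k (fun x => resFactor c X τ j x ω) := by
  have h1 : ∀ ω, SNorm b k (fun x => resFactor c X τ j x ω) =
      ⨆ q : ℚ, sWeight b k (fun x => resFactor c X τ j x ω) q := fun ω =>
    SNorm_eq_iSup_rat (memS_resolvent hb.1 hb.2 _ (hτ0 ω) (hτ1 ω) (X ω)) k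
  simp_rw [h1]
  refine Measurable.iSup fun q => ?_
  have h2 : ∀ ω, sWeight b k (fun x => resFactor c X τ j x ω) q =
      ‖(if j = 0 then c ω else 1) * (k.factorial * ((zpt (X ω) (τ ω) - (q : ℝ))⁻¹) ^ (k + 1))‖ *
        jb q ^ ((k : ℝ) - b) := fun ω => by
    have hz : (zpt (X ω) (τ ω)).im ≠ 0 := by
      have := zpt_sub_im (X ω) (τ ω) 0
      simp only [Complex.ofReal_zero, sub_zero] at this
      rw [this]; exact mul_ne_zero (hτ0 ω) (jb_pos _).ne'
    simp only [sWeight, resFactor]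
    rw [iteratedDeriv_resolvent _ _ hz]
  simp_rw [h2]
  have h3 : Measurable fun ω => zpt (X ω) (τ ω) := continuous_zpt.measurable.comp (hX.prodMk hτ)
  split_ifs <;> fun_prop

/-- A superposition of products of resolvents is an admissible integral representation. -/
theorem isBoxRep_resFactor {n : ℕ} {α : ℝ} {β : Fin (n + 1) → ℝ}
    (hβ : ∀ j, -1 ≤ β j ∧ β j ≤ 0) (hsum : ∑ j, β j = α - n) {Ω : Type} [mΩ : MeasurableSpace Ω]
    {ν : Measure Ω} [SigmaFinite ν] {c : Ω → ℂ} {X τ : Ω → ℝ} (hc : Measurable c)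
    (hX : Measurable X) (hτ : Measurable τ) (hτ0 : ∀ ω, τ ω ≠ 0) (hτ1 : ∀ ω, |τ ω| ≤ 1)
    (hint : ∀ K : ℕ,
      Integrable (fun ω => ‖c ω‖ * ((|τ ω|⁻¹) ^ (K + n + 1) * jb (X ω) ^ (-1 - α))) ν)
    {φ : (Fin (n + 1) → ℝ) → ℂ}
    (hφ : ∀ lam, φ lam = ∫ ω, c ω * resProd lam (zpt (X ω) (τ ω)) ∂ν) :
    IsBoxRep β φ Ω mΩ ν (resFactor c X τ) := by
  refine ⟨inferInstance, fun j => ?_, fun j ω => memS_resolvent (hβ j).1 (hβ j).2 _ (hτ0 ω)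
    (hτ1 ω) (X ω), fun j k => measurable_SNorm_resFactor (hβ j) hc hX hτ hτ0 hτ1 j k,
    fun lam => ?_, fun k => ?_⟩
  · have h3 : Measurable fun p : ℝ × Ω => zpt (X p.2) (τ p.2) :=
      continuous_zpt.measurable.comp ((hX.comp measurable_snd).prodMk (hτ.comp measurable_snd))
    simp only [Function.uncurry_def, resFactor]
    split_ifs <;> fun_prop
  · rw [hφ]
    refine integral_congr_ae (Eventually.of_forall fun ω => ?_)
    simp only [resFactor, resProd, Finset.prod_mul_distrib]
    congr 1
    rw [Fin.prod_univ_succ]; simp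
  · refine ((hint (∑ j, k j)).const_mul (∏ j, ((k j).factorial * 2 ^ (k j + 1) : ℝ))).mono'
      (Finset.measurable_prod _ fun j _ => measurable_SNorm_resFactor (hβ j) hc hX hτ hτ0 hτ1 j
        (k j)).aestronglyMeasurable (Eventually.of_forall fun ω => ?_)
    rw [Real.norm_of_nonneg (Finset.prod_nonneg fun j _ => SNorm_nonneg _ _ _)]
    exact prod_SNorm_resFactor_le hβ hsum hτ0 hτ1 k ω

lemma lintegral_prod_SNorm_resFactor_le {n : ℕ} {α : ℝ} {β : Fin (n + 1) → ℝ}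
    (hβ : ∀ j, -1 ≤ β j ∧ β j ≤ 0) (hsum : ∑ j, β j = α - n) {Ω : Type} [MeasurableSpace Ω]
    (ν : Measure Ω) {c : Ω → ℂ} {X τ : Ω → ℝ} (hτ0 : ∀ ω, τ ω ≠ 0) (hτ1 : ∀ ω, |τ ω| ≤ 1)
    (k : Fin (n + 1) → ℕ) :
    ∫⁻ ω, ∏ j, ENNReal.ofReal (SNorm (β j) (k j) (fun x => resFactor c X τ j x ω)) ∂ν ≤
      ENNReal.ofReal (∏ j, ((k j).factorial * 2 ^ (k j + 1) : ℝ)) * ∫⁻ ω, ENNReal.ofReal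
        (‖c ω‖ * ((|τ ω|⁻¹) ^ ((∑ j, k j) + n + 1) * jb (X ω) ^ (-1 - α))) ∂ν := by
  rw [← lintegral_const_mul' _ _ ENNReal.ofReal_ne_top]
  refine lintegral_mono fun ω => ?_
  rw [← ENNReal.ofReal_prod_of_nonneg fun j _ => SNorm_nonneg _ _ _,
    ← ENNReal.ofReal_mul (by positivity)]
  exact ENNReal.ofReal_le_ofReal (prod_SNorm_resFactor_le hβ hsum hτ0 hτ1 k ω)

/-- A superposition of products of resolvents depends continuously on `λ`. -/
lemma continuous_integral_resProd {n : ℕ} {α : ℝ} (hα : α ≤ n) {Ω : Type} [MeasurableSpace Ω]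
    {ν : Measure Ω} {c : Ω → ℂ} {X τ : Ω → ℝ} (hc : Measurable c)
    (hX : Measurable X) (hτ : Measurable τ) (hτ0 : ∀ ω, τ ω ≠ 0)
    (hint : Integrable (fun ω => ‖c ω‖ * ((|τ ω|⁻¹) ^ (n + 1) * jb (X ω) ^ (-1 - α))) ν) :
    Continuous fun lam : Fin (n + 1) → ℝ => ∫ ω, c ω * resProd lam (zpt (X ω) (τ ω)) ∂ν := by
  refine continuous_of_dominated (fun lam => ?_) (fun lam => Eventually.of_forall fun ω => ?_) hint
    (Eventually.of_forall fun ω => ?_)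
  · exact (hc.mul ((measurable_resProd lam).comp (continuous_zpt.measurable.comp
      (hX.prodMk hτ)))).aestronglyMeasurable
  · rw [norm_mul]
    gcongr
    refine (norm_resProd_le lam (hτ0 ω) (X ω)).trans ?_
    gcongr
    rw [inv_pow, ← Real.rpow_natCast, ← Real.rpow_neg (jb_pos _).le]
    exact Real.rpow_le_rpow_of_exponent_le (one_le_jb _) (by push_cast; linarith)
  · simp only [resProd]
    refine continuous_const.mul (continuous_finsetProd _ fun j _ => ?_)
    exact Continuous.inv₀ (by fun_prop) fun lam => zpt_sub_ne_zero (hτ0 ω) _ _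

lemma eq_zero_of_tendsto_of_integrable_div_jb {E : ℝ → ℂ} {L : ℂ}
    (hE : Integrable fun x => ‖E x‖ * (jb x)⁻¹) (hL : Tendsto E atTop (𝓝 L)) : L = 0 := by
  by_contra hne
  have hL0 : 0 < ‖L‖ := norm_pos_iff.2 hne
  have h1 : ∀ᶠ x in atTop, ‖L‖ / 2 < ‖E x‖ := hL.norm.eventually_const_lt (by linarith)
  obtain ⟨A, hA⟩ := eventually_atTop.1 (h1.and (eventually_ge_atTop 1))
  refine not_integrableOn_Ioi_inv (a := A) ?_
  refine ((hE.integrableOn (s := Set.Ioi A)).const_mul (4 / ‖L‖)).mono'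
    measurable_inv.aestronglyMeasurable ?_
  filter_upwards [ae_restrict_mem measurableSet_Ioi] with x hx
  obtain ⟨h2, h3⟩ := hA x (le_of_lt hx)
  have h4 : jb x ≤ 2 * x := by
    have := jb_le_add 0 x
    have h0 : jb 0 = 1 := by simp [jb]
    rw [h0, sub_zero, abs_of_pos (by linarith)] at this
    linarith
  have h5 : (2 * x)⁻¹ ≤ (jb x)⁻¹ := inv_anti₀ (jb_pos x) h4
  rw [Real.norm_of_nonneg (by positivity)]
  calc x⁻¹ = 4 / ‖L‖ * (‖L‖ / 2 * (2 * x)⁻¹) := by field_simp; norm_num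
    _ ≤ 4 / ‖L‖ * (‖E x‖ * (jb x)⁻¹) := by gcongr

/-- An integrable derivative has vanishing integral if its primitive divided by `⟨x⟩` is
integrable. -/
lemma integral_deriv_eq_zero_of_integrable_div_jb {E E' : ℝ → ℂ}
    (hd : ∀ x, HasDerivAt E (E' x) x) (hE' : Integrable E')
    (hE : Integrable fun x => ‖E x‖ * (jb x)⁻¹) : ∫ x, E' x = 0 := by
  have h1 := tendsto_limUnder_of_hasDerivAt_of_integrableOn_Ioi (a := 0)
    (fun x _ => hd x) hE'.integrableOn
  have h2 := tendsto_limUnder_of_hasDerivAt_of_integrableOn_Iic (a := 0)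
    (fun x _ => hd x) hE'.integrableOn
  have e1 := eq_zero_of_tendsto_of_integrable_div_jb hE h1
  have e2 : limUnder atBot E = 0 := by
    refine eq_zero_of_tendsto_of_integrable_div_jb (E := fun x => E (-x)) ?_
      (h2.comp tendsto_neg_atTop_atBot)
    have := hE.comp_neg
    simpa [jb] using this
  rw [integral_of_hasDerivAt_of_tendsto hd hE' h2 h1, e1, e2, sub_zero]

lemma hasDerivAt_resProd {ι : Type*} [Fintype ι] (lam : ι → ℝ) {z : ℂ}
    (hz : ∀ j, z - lam j ≠ 0) :
    HasDerivAt (resProd lam) (-(resProd lam z * ∑ j, (z - lam j)⁻¹)) z := by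
  classical
  have h1 : ∀ j ∈ Finset.univ, HasDerivAt (fun z : ℂ => (z - lam j)⁻¹)
      (-(((z - lam j)⁻¹) * (z - lam j)⁻¹)) z := fun j _ => by
    have := ((hasDerivAt_id z).sub_const (lam j : ℂ)).fun_inv (hz j)
    refine this.congr_deriv ?_
    rw [neg_div, one_div, ← mul_inv, sq]; rfl
  refine (HasDerivAt.fun_finsetProd h1).congr_deriv ?_
  rw [Finset.mul_sum, ← Finset.sum_neg_distrib]
  refine Finset.sum_congr rfl fun j hj => ?_
  rw [resProd, ← Finset.prod_erase_mul _ _ hj, smul_eq_mul]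
  ring

/-- The increment `z - x` at `z = x + i t ⟨x⟩`. -/
def wpt (x t : ℝ) : ℂ := ((t * jb x : ℝ) : ℂ) * Complex.I

lemma norm_wpt (x t : ℝ) : ‖wpt x t‖ = |t| * jb x := by
  simp [wpt, abs_of_pos (jb_pos x)]

/-- The coefficient of the `r`-th Taylor term on the contour `x ↦ x + i t ⟨x⟩`. -/
def jCoef (f : ℝ → ℂ) (r : ℕ) (x t : ℝ) : ℂ :=
  iteratedDeriv r f x * (wpt x t ^ r / r.factorial) *
    (1 + ((t * (x / jb x) : ℝ) : ℂ) * Complex.I)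

/-- The coefficient exchanged between consecutive Taylor terms when the contour moves. -/
def dCoef (f : ℝ → ℂ) (r : ℕ) (x t : ℝ) : ℂ :=
  iteratedDeriv (r + 1) f x * (wpt x t ^ r / r.factorial) * (jb x * Complex.I)

/-- The `r`-th Taylor term of the contour integrand over `x ↦ x + i t ⟨x⟩`. -/
def jTerm {n : ℕ} (f : ℝ → ℂ) (lam : Fin (n + 1) → ℝ) (r : ℕ) (x t : ℝ) : ℂ :=
  jCoef f r x t * resProd lam (zpt x t)

/-- The density exchanged between consecutive Taylor terms when the contour moves. -/
def dTerm {n : ℕ} (f : ℝ → ℂ) (lam : Fin (n + 1) → ℝ) (r : ℕ) (x t : ℝ) : ℂ :=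
  dCoef f r x t * resProd lam (zpt x t)

/-- `dTerm (r - 1)`, understood as `0` for `r = 0`. -/
def dPrev {n : ℕ} (f : ℝ → ℂ) (lam : Fin (n + 1) → ℝ) (r : ℕ) (x t : ℝ) : ℂ :=
  iteratedDeriv r f x * (r * wpt x t ^ (r - 1) / r.factorial) * (jb x * Complex.I) *
    resProd lam (zpt x t)

lemma dPrev_zero {n : ℕ} (f : ℝ → ℂ) (lam : Fin (n + 1) → ℝ) (x t : ℝ) :
    dPrev f lam 0 x t = 0 := by simp [dPrev]

lemma dPrev_succ {n : ℕ} (f : ℝ → ℂ) (lam : Fin (n + 1) → ℝ) (r : ℕ) (x t : ℝ) :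
    dPrev f lam (r + 1) x t = dTerm f lam r x t := by
  have h : ((r : ℂ) + 1) ≠ 0 := by exact_mod_cast Nat.succ_ne_zero r
  have h2 : (r.factorial : ℂ) ≠ 0 := by exact_mod_cast r.factorial_ne_zero
  simp only [dPrev, dTerm, dCoef, Nat.factorial_succ, Nat.add_sub_cancel]
  push_cast
  field_simp

/-- The derivative of `jTerm` in `t`. -/
def jTermDeriv {n : ℕ} (f : ℝ → ℂ) (lam : Fin (n + 1) → ℝ) (r : ℕ) (x t : ℝ) : ℂ :=
  iteratedDeriv r f x * (r * wpt x t ^ (r - 1) * (jb x * Complex.I) / r.factorial) *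
      (1 + ((t * (x / jb x) : ℝ) : ℂ) * Complex.I) * resProd lam (zpt x t) +
    iteratedDeriv r f x * (wpt x t ^ r / r.factorial) *
      (((x / jb x : ℝ) : ℂ) * Complex.I) * resProd lam (zpt x t) +
    iteratedDeriv r f x * (wpt x t ^ r / r.factorial) *
      (1 + ((t * (x / jb x) : ℝ) : ℂ) * Complex.I) *
      (-(resProd lam (zpt x t) * ∑ j, (zpt x t - lam j)⁻¹) * (jb x * Complex.I))

lemma hasDerivAt_ofReal_mul_I {g : ℝ → ℝ} {g' t : ℝ} (h : HasDerivAt g g' t) :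
    HasDerivAt (fun t => ((g t : ℝ) : ℂ) * Complex.I) ((g' : ℂ) * Complex.I) t :=
  h.ofReal_comp.mul_const Complex.I

lemma hasDerivAt_jTerm {n : ℕ} (f : ℝ → ℂ) (lam : Fin (n + 1) → ℝ) (r : ℕ) (x : ℝ) {t : ℝ}
    (ht : t ≠ 0) : HasDerivAt (fun t => jTerm f lam r x t) (jTermDeriv f lam r x t) t := by
  have h1 : HasDerivAt (fun t => wpt x t) (jb x * Complex.I) t := by
    have := hasDerivAt_ofReal_mul_I ((hasDerivAt_id t).mul_const (jb x))
    simpa [wpt] using this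
  have h2 : HasDerivAt (fun t => zpt x t) (jb x * Complex.I) t := h1.const_add (x : ℂ)
  have h3 : HasDerivAt (fun t => 1 + ((t * (x / jb x) : ℝ) : ℂ) * Complex.I)
      (((x / jb x : ℝ) : ℂ) * Complex.I) t := by
    have := hasDerivAt_ofReal_mul_I ((hasDerivAt_id t).mul_const (x / jb x))
    simpa using this.const_add (1 : ℂ)
  have h4 := (hasDerivAt_resProd lam fun j => zpt_sub_ne_zero ht x (lam j)).comp t h2
  have h5 := ((((h1.fun_pow r).div_const (r.factorial : ℂ)).const_mul
    (iteratedDeriv r f x)).mul h3).mul h4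
  refine h5.congr_deriv ?_
  simp only [jTermDeriv, Function.comp_apply, Pi.mul_apply]
  ring

/-- The primitive in `x` of the difference between `jTermDeriv` and the exchanged densities. -/
def eTerm {n : ℕ} (f : ℝ → ℂ) (lam : Fin (n + 1) → ℝ) (r : ℕ) (t x : ℝ) : ℂ :=
  iteratedDeriv r f x * (wpt x t ^ r / r.factorial) * (jb x * Complex.I) * resProd lam (zpt x t)

lemma hasDerivAt_eTerm {n : ℕ} {f : ℝ → ℂ} (hf : ContDiff ℝ (⊤ : ℕ∞) f)
    (lam : Fin (n + 1) → ℝ) (r : ℕ) (x : ℝ) {t : ℝ} (ht : t ≠ 0) :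
    HasDerivAt (eTerm f lam r t)
      (jTermDeriv f lam r x t - dPrev f lam r x t + dTerm f lam r x t) x := by
  have h0 : HasDerivAt (iteratedDeriv r f) (iteratedDeriv (r + 1) f x) x := by
    rw [iteratedDeriv_succ]
    exact (hf.differentiable_iteratedDeriv r (by exact_mod_cast ENat.natCast_lt_top r) x).hasDerivAt
  have h1 : HasDerivAt (fun x => wpt x t) (((t * (x / jb x) : ℝ) : ℂ) * Complex.I) x :=
    hasDerivAt_ofReal_mul_I ((hasDerivAt_jb x).const_mul t)
  have h2 : HasDerivAt (fun x => zpt x t) (1 + ((t * (x / jb x) : ℝ) : ℂ) * Complex.I) x :=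
    (Complex.ofRealCLM.hasDerivAt (x := x)).add h1
  have h3 : HasDerivAt (fun x => (jb x : ℂ) * Complex.I) (((x / jb x : ℝ) : ℂ) * Complex.I) x :=
    hasDerivAt_ofReal_mul_I (hasDerivAt_jb x)
  have h4 := (hasDerivAt_resProd lam fun j => zpt_sub_ne_zero ht x (lam j)).comp x h2
  have h5 := ((h0.mul ((h1.fun_pow r).div_const (r.factorial : ℂ))).mul h3).mul h4
  refine h5.congr_deriv ?_
  simp only [jTermDeriv, dPrev, dTerm, dCoef, Function.comp_apply, Pi.mul_apply]
  ring

lemma norm_one_add_le {t : ℝ} (ht1 : |t| ≤ 1) (x : ℝ) :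
    ‖(1 : ℂ) + ((t * (x / jb x) : ℝ) : ℂ) * Complex.I‖ ≤ 2 := by
  refine (norm_add_le _ _).trans ?_
  rw [norm_one, norm_mul, Complex.norm_I, mul_one, Complex.norm_real, Real.norm_eq_abs, abs_mul]
  have := mul_le_one₀ ht1 (abs_nonneg _) (abs_div_jb_le x)
  linarith

lemma norm_one_div_factorial_le (w : ℂ) (r : ℕ) : ‖w / (r.factorial : ℂ)‖ ≤ ‖w‖ := by
  rw [norm_div, Complex.norm_natCast]
  exact div_le_self (norm_nonneg _) (by exact_mod_cast r.factorial_pos)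

lemma norm_jCoef_le (f : ℝ → ℂ) (r : ℕ) (x : ℝ) {t : ℝ} (ht1 : |t| ≤ 1) :
    ‖jCoef f r x t‖ ≤ 2 * |t| ^ r * (‖iteratedDeriv r f x‖ * jb x ^ r) := by
  have h1 : ‖wpt x t ^ r / (r.factorial : ℂ)‖ ≤ |t| ^ r * jb x ^ r := by
    refine (norm_one_div_factorial_le _ _).trans ?_
    rw [norm_pow, norm_wpt, mul_pow]
  have h2 := norm_one_add_le ht1 x
  have hj := jb_pos x
  rw [jCoef, norm_mul, norm_mul]
  calc _ ≤ ‖iteratedDeriv r f x‖ * (|t| ^ r * jb x ^ r) * 2 := by gcongr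
    _ = _ := by ring

lemma norm_dCoef_le (f : ℝ → ℂ) (r : ℕ) (x t : ℝ) :
    ‖dCoef f r x t‖ ≤ |t| ^ r * (‖iteratedDeriv (r + 1) f x‖ * jb x ^ (r + 1)) := by
  have h1 : ‖wpt x t ^ r / (r.factorial : ℂ)‖ ≤ |t| ^ r * jb x ^ r := by
    refine (norm_one_div_factorial_le _ _).trans ?_
    rw [norm_pow, norm_wpt, mul_pow]
  rw [dCoef, norm_mul, norm_mul, norm_mul, Complex.norm_I, mul_one, Complex.norm_real,
    Real.norm_of_nonneg (jb_pos x).le]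
  have := jb_pos x
  calc _ ≤ ‖iteratedDeriv (r + 1) f x‖ * (|t| ^ r * jb x ^ r) * jb x := by gcongr
    _ = _ := by ring

lemma tWeight_nonneg (b : ℝ) (k : ℕ) (f : ℝ → ℂ) (x : ℝ) : 0 ≤ tWeight b k f x :=
  mul_nonneg (norm_nonneg _) (Real.rpow_nonneg (jb_pos x).le _)

lemma tWeight_eq (α : ℝ) (r : ℕ) (f : ℝ → ℂ) (x : ℝ) :
    tWeight α r f x = ‖iteratedDeriv r f x‖ * jb x ^ r * jb x ^ (-1 - α) := by
  rw [tWeight, mul_assoc, ← Real.rpow_natCast, ← Real.rpow_add (jb_pos _)]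
  congr 2; ring

lemma norm_jCoef_mul_le (α : ℝ) (f : ℝ → ℂ) (r m : ℕ) (x : ℝ) {t : ℝ} (ht1 : |t| ≤ 1) :
    ‖jCoef f r x t‖ * ((|t|⁻¹) ^ m * jb x ^ (-1 - α)) ≤
      2 * |t| ^ r * (|t|⁻¹) ^ m * tWeight α r f x := by
  have := Real.rpow_nonneg (jb_pos x).le (-1 - α)
  rw [tWeight_eq]
  calc _ ≤ 2 * |t| ^ r * (‖iteratedDeriv r f x‖ * jb x ^ r) *
        ((|t|⁻¹) ^ m * jb x ^ (-1 - α)) := by gcongr; exact norm_jCoef_le f r x ht1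
    _ = _ := by ring

lemma norm_dCoef_mul_le (α : ℝ) (f : ℝ → ℂ) (r m : ℕ) (x t : ℝ) :
    ‖dCoef f r x t‖ * ((|t|⁻¹) ^ m * jb x ^ (-1 - α)) ≤
      |t| ^ r * (|t|⁻¹) ^ m * tWeight α (r + 1) f x := by
  have := Real.rpow_nonneg (jb_pos x).le (-1 - α)
  rw [tWeight_eq]
  calc _ ≤ |t| ^ r * (‖iteratedDeriv (r + 1) f x‖ * jb x ^ (r + 1)) *
        ((|t|⁻¹) ^ m * jb x ^ (-1 - α)) := by gcongr; exact norm_dCoef_le f r x t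
    _ = _ := by ring

lemma inv_pow_jb_le {n : ℕ} {α : ℝ} (hα : α ≤ n) (x : ℝ) :
    ((jb x)⁻¹) ^ (n + 1) ≤ jb x ^ (-1 - α) := by
  rw [inv_pow, ← Real.rpow_natCast, ← Real.rpow_neg (jb_pos _).le]
  exact Real.rpow_le_rpow_of_exponent_le (one_le_jb _) (by push_cast; linarith)

lemma norm_resProd_le_rpow {n : ℕ} {α : ℝ} (hα : α ≤ n) (lam : Fin (n + 1) → ℝ) {t : ℝ}
    (ht : t ≠ 0) (x : ℝ) :
    ‖resProd lam (zpt x t)‖ ≤ (|t|⁻¹) ^ (n + 1) * jb x ^ (-1 - α) :=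
  (norm_resProd_le lam ht x).trans (by gcongr; exact inv_pow_jb_le hα x)

lemma norm_jTerm_le {n : ℕ} {α : ℝ} (hα : α ≤ n) (f : ℝ → ℂ) (lam : Fin (n + 1) → ℝ) (r : ℕ)
    (x : ℝ) {t : ℝ} (ht : t ≠ 0) (ht1 : |t| ≤ 1) :
    ‖jTerm f lam r x t‖ ≤ 2 * |t| ^ r * (|t|⁻¹) ^ (n + 1) * tWeight α r f x := by
  rw [jTerm, norm_mul]
  exact (mul_le_mul_of_nonneg_left (norm_resProd_le_rpow hα lam ht x) (norm_nonneg _)).trans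
    (norm_jCoef_mul_le α f r (n + 1) x ht1)

lemma norm_dTerm_le {n : ℕ} {α : ℝ} (hα : α ≤ n) (f : ℝ → ℂ) (lam : Fin (n + 1) → ℝ) (r : ℕ)
    (x : ℝ) {t : ℝ} (ht : t ≠ 0) :
    ‖dTerm f lam r x t‖ ≤ |t| ^ r * (|t|⁻¹) ^ (n + 1) * tWeight α (r + 1) f x := by
  rw [dTerm, norm_mul]
  exact (mul_le_mul_of_nonneg_left (norm_resProd_le_rpow hα lam ht x) (norm_nonneg _)).trans
    (norm_dCoef_mul_le α f r (n + 1) x t)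

lemma norm_eTerm_le {n : ℕ} {α : ℝ} (hα : α ≤ n) (f : ℝ → ℂ) (lam : Fin (n + 1) → ℝ) (r : ℕ)
    (x : ℝ) {t : ℝ} (ht : t ≠ 0) :
    ‖eTerm f lam r t x‖ * (jb x)⁻¹ ≤ |t| ^ r * (|t|⁻¹) ^ (n + 1) * tWeight α r f x := by
  have h1 : ‖wpt x t ^ r / (r.factorial : ℂ)‖ ≤ |t| ^ r * jb x ^ r := by
    refine (norm_one_div_factorial_le _ _).trans ?_
    rw [norm_pow, norm_wpt, mul_pow]
  have hj := jb_pos x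
  rw [eTerm, norm_mul, norm_mul, norm_mul, norm_mul, Complex.norm_I, mul_one, Complex.norm_real,
    Real.norm_of_nonneg hj.le, tWeight_eq]
  have := norm_resProd_le_rpow hα lam ht x
  have := Real.rpow_nonneg hj.le (-1 - α)
  calc _ ≤ ‖iteratedDeriv r f x‖ * (|t| ^ r * jb x ^ r) * jb x *
        ((|t|⁻¹) ^ (n + 1) * jb x ^ (-1 - α)) * (jb x)⁻¹ := by gcongr
    _ = _ := by field_simp

lemma norm_jTermDeriv_le {n : ℕ} {α : ℝ} (hα : α ≤ n) (f : ℝ → ℂ) (lam : Fin (n + 1) → ℝ)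
    (r : ℕ) {δ : ℝ} (hδ : 0 < δ) (x : ℝ) {t : ℝ} (ht : δ ≤ |t|) (ht1 : |t| ≤ 1) :
    ‖jTermDeriv f lam r x t‖ ≤
      (2 * r + 1 + 2 * (n + 1) * δ⁻¹) * (δ⁻¹) ^ (n + 1) * tWeight α r f x := by
  have ht0 : t ≠ 0 := abs_pos.1 (hδ.trans_le ht)
  have hj := jb_pos x
  have hti : |t|⁻¹ ≤ δ⁻¹ := inv_anti₀ hδ ht
  have hδ' : 0 < δ⁻¹ := inv_pos.2 hδ
  have hw : ‖wpt x t‖ ≤ jb x := by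
    rw [norm_wpt]; exact mul_le_of_le_one_left hj.le ht1
  have hR : ‖resProd lam (zpt x t)‖ ≤ (δ⁻¹) ^ (n + 1) * jb x ^ (-1 - α) :=
    (norm_resProd_le_rpow hα lam ht0 x).trans (by gcongr)
  have hS : ‖∑ j, (zpt x t - lam j)⁻¹‖ ≤ (n + 1) * (δ⁻¹ * (jb x)⁻¹) := by
    refine (norm_sum_le _ _).trans ?_
    refine (Finset.sum_le_sum fun j _ => (norm_inv_zpt_sub_le ht0 x (lam j)).trans
      (mul_le_mul_of_nonneg_right hti (inv_pos.2 hj).le)).trans ?_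
    simp
  have h2 := norm_one_add_le ht1 x
  have h3 : ‖wpt x t ^ r / (r.factorial : ℂ)‖ ≤ jb x ^ r :=
    (norm_one_div_factorial_le _ _).trans (by rw [norm_pow]; gcongr)
  have h4 : ‖r * wpt x t ^ (r - 1) * (jb x * Complex.I) / (r.factorial : ℂ)‖ ≤ r * jb x ^ r := by
    refine (norm_one_div_factorial_le _ _).trans ?_
    rw [norm_mul, norm_mul, norm_mul, norm_pow, Complex.norm_I, mul_one, Complex.norm_real,
      Real.norm_of_nonneg hj.le, Complex.norm_natCast]
    rcases r with _ | r
    · simp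
    · rw [Nat.add_sub_cancel, pow_succ, mul_assoc]
      gcongr
  have h5 : ‖((x / jb x : ℝ) : ℂ) * Complex.I‖ ≤ 1 := by
    rw [norm_mul, Complex.norm_I, mul_one, Complex.norm_real]; exact abs_div_jb_le x
  have h6 : ‖(jb x : ℂ) * Complex.I‖ = jb x := by
    rw [norm_mul, Complex.norm_I, mul_one, Complex.norm_real, Real.norm_of_nonneg hj.le]
  have hp := Real.rpow_nonneg hj.le (-1 - α)
  rw [jTermDeriv]
  refine (norm_add₃_le).trans ?_
  rw [tWeight_eq]
  calc _ ≤ ‖iteratedDeriv r f x‖ * (r * jb x ^ r) * 2 * ((δ⁻¹) ^ (n + 1) * jb x ^ (-1 - α)) +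
        ‖iteratedDeriv r f x‖ * jb x ^ r * 1 * ((δ⁻¹) ^ (n + 1) * jb x ^ (-1 - α)) +
        ‖iteratedDeriv r f x‖ * jb x ^ r * 2 * (((δ⁻¹) ^ (n + 1) * jb x ^ (-1 - α)) *
          ((n + 1) * (δ⁻¹ * (jb x)⁻¹)) * jb x) :=
      add_le_add (add_le_add
        (norm_mul_le_of_le (norm_mul_le_of_le (norm_mul_le_of_le le_rfl h4) h2) hR)
        (norm_mul_le_of_le (norm_mul_le_of_le (norm_mul_le_of_le le_rfl h3) h5) hR))
        (norm_mul_le_of_le (norm_mul_le_of_le (norm_mul_le_of_le le_rfl h3) h2)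
          (norm_mul_le_of_le (by rw [norm_neg]; exact norm_mul_le_of_le hR hS) h6.le))
    _ = _ := by field_simp

lemma continuous_iteratedDeriv_of_contDiff {f : ℝ → ℂ} (hf : ContDiff ℝ (⊤ : ℕ∞) f) (r : ℕ) :
    Continuous (iteratedDeriv r f) :=
  hf.continuous_iteratedDeriv r (by exact_mod_cast le_top)

lemma continuous_wpt : Continuous (fun p : ℝ × ℝ => wpt p.1 p.2) := by
  have := continuous_jb
  unfold wpt
  fun_prop

lemma continuous_div_jb : Continuous (fun x => x / jb x) :=
  continuous_id.div continuous_jb fun x => (jb_pos x).ne'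

lemma continuous_one_add : Continuous
    (fun p : ℝ × ℝ => (1 : ℂ) + ((p.2 * (p.1 / jb p.1) : ℝ) : ℂ) * Complex.I) := by
  have h := continuous_div_jb.comp (continuous_fst (X := ℝ) (Y := ℝ))
  simp only [Function.comp_def] at h
  fun_prop

lemma continuous_jCoef {f : ℝ → ℂ} (hf : ContDiff ℝ (⊤ : ℕ∞) f) (r : ℕ) :
    Continuous (fun p : ℝ × ℝ => jCoef f r p.1 p.2) :=
  (((continuous_iteratedDeriv_of_contDiff hf r).comp continuous_fst).mul
    ((continuous_wpt.pow r).div_const _)).mul continuous_one_add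

lemma continuous_dCoef {f : ℝ → ℂ} (hf : ContDiff ℝ (⊤ : ℕ∞) f) (r : ℕ) :
    Continuous (fun p : ℝ × ℝ => dCoef f r p.1 p.2) := by
  have h := continuous_jb
  exact (((continuous_iteratedDeriv_of_contDiff hf (r + 1)).comp continuous_fst).mul
    ((continuous_wpt.pow r).div_const _)).mul (by fun_prop)

lemma measurable_resProd_zpt {n : ℕ} (lam : Fin (n + 1) → ℝ) :
    Measurable (fun p : ℝ × ℝ => resProd lam (zpt p.1 p.2)) :=
  (measurable_resProd lam).comp continuous_zpt.measurable

lemma measurable_jTerm {n : ℕ} {f : ℝ → ℂ} (hf : ContDiff ℝ (⊤ : ℕ∞) f)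
    (lam : Fin (n + 1) → ℝ) (r : ℕ) : Measurable (fun p : ℝ × ℝ => jTerm f lam r p.1 p.2) :=
  (continuous_jCoef hf r).measurable.mul (measurable_resProd_zpt lam)

lemma measurable_dTerm {n : ℕ} {f : ℝ → ℂ} (hf : ContDiff ℝ (⊤ : ℕ∞) f)
    (lam : Fin (n + 1) → ℝ) (r : ℕ) : Measurable (fun p : ℝ × ℝ => dTerm f lam r p.1 p.2) :=
  (continuous_dCoef hf r).measurable.mul (measurable_resProd_zpt lam)

lemma measurable_jTermDeriv {n : ℕ} {f : ℝ → ℂ} (hf : ContDiff ℝ (⊤ : ℕ∞) f)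
    (lam : Fin (n + 1) → ℝ) (r : ℕ) :
    Measurable (fun p : ℝ × ℝ => jTermDeriv f lam r p.1 p.2) := by
  have h0 := continuous_jb.measurable
  have h1 := (continuous_iteratedDeriv_of_contDiff hf r).measurable
  have h2 := continuous_wpt.measurable
  have h3 := continuous_one_add.measurable
  have h4 := measurable_resProd_zpt lam
  have h5 := continuous_zpt.measurable
  have h6 := continuous_div_jb.measurable
  unfold jTermDeriv
  refine ((((h1.comp measurable_fst).mul ?_).mul h3).mul h4).add
    ((((h1.comp measurable_fst).mul ?_).mul ?_).mul h4) |>.add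
    ((((h1.comp measurable_fst).mul ?_).mul h3).mul ((h4.mul ?_).neg.mul ?_))
  all_goals fun_prop

lemma integrable_jTerm {n : ℕ} {α : ℝ} (hα : α ≤ n) {f : ℝ → ℂ} (hf : MemT α f)
    (lam : Fin (n + 1) → ℝ) (r : ℕ) {t : ℝ} (ht : t ≠ 0) (ht1 : |t| ≤ 1) :
    Integrable (fun x => jTerm f lam r x t) :=
  ((hf.2 r).const_mul _).mono'
    ((measurable_jTerm hf.1 lam r).comp measurable_prodMk_right).aestronglyMeasurable
    (.of_forall fun x => norm_jTerm_le hα f lam r x ht ht1)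

lemma integrable_dTerm {n : ℕ} {α : ℝ} (hα : α ≤ n) {f : ℝ → ℂ} (hf : MemT α f)
    (lam : Fin (n + 1) → ℝ) (r : ℕ) {t : ℝ} (ht : t ≠ 0) :
    Integrable (fun x => dTerm f lam r x t) :=
  ((hf.2 (r + 1)).const_mul _).mono'
    ((measurable_dTerm hf.1 lam r).comp measurable_prodMk_right).aestronglyMeasurable
    (.of_forall fun x => norm_dTerm_le hα f lam r x ht)

lemma integrable_dPrev {n : ℕ} {α : ℝ} (hα : α ≤ n) {f : ℝ → ℂ} (hf : MemT α f)
    (lam : Fin (n + 1) → ℝ) (r : ℕ) {t : ℝ} (ht : t ≠ 0) :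
    Integrable (fun x => dPrev f lam r x t) := by
  rcases r with _ | r
  · simp only [dPrev_zero]; exact integrable_zero _ _ _
  · simp only [dPrev_succ]; exact integrable_dTerm hα hf lam r ht

lemma integrable_jTermDeriv {n : ℕ} {α : ℝ} (hα : α ≤ n) {f : ℝ → ℂ} (hf : MemT α f)
    (lam : Fin (n + 1) → ℝ) (r : ℕ) {t : ℝ} (ht : t ≠ 0) (ht1 : |t| ≤ 1) :
    Integrable (fun x => jTermDeriv f lam r x t) :=
  ((hf.2 r).const_mul _).mono'
    ((measurable_jTermDeriv hf.1 lam r).comp measurable_prodMk_right).aestronglyMeasurable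
    (.of_forall fun x => norm_jTermDeriv_le hα f lam r (abs_pos.2 ht) x le_rfl ht1)

lemma integral_jTermDeriv {n : ℕ} {α : ℝ} (hα : α ≤ n) {f : ℝ → ℂ} (hf : MemT α f)
    (lam : Fin (n + 1) → ℝ) (r : ℕ) {t : ℝ} (ht : t ≠ 0) (ht1 : |t| ≤ 1) :
    ∫ x, jTermDeriv f lam r x t = (∫ x, dPrev f lam r x t) - ∫ x, dTerm f lam r x t := by
  have i1 := integrable_jTermDeriv hα hf lam r ht ht1
  have i2 := integrable_dPrev hα hf lam r ht
  have i3 := integrable_dTerm hα hf lam r ht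
  have hd := fun x => hasDerivAt_eTerm hf.1 lam r x ht
  have hc : Continuous (eTerm f lam r t) :=
    continuous_iff_continuousAt.2 fun x => (hd x).continuousAt
  have h := integral_deriv_eq_zero_of_integrable_div_jb hd ((i1.sub i2).add i3) <| by
    refine ((hf.2 r).const_mul (|t| ^ r * (|t|⁻¹) ^ (n + 1))).mono'
      (hc.norm.measurable.mul continuous_jb.measurable.inv).aestronglyMeasurable
      (.of_forall fun x => ?_)
    · rw [Real.norm_of_nonneg (mul_nonneg (norm_nonneg _) (inv_pos.2 (jb_pos x)).le)]
      exact norm_eTerm_le hα f lam r x ht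
  have e1 : ∫ x, (jTermDeriv f lam r x t - dPrev f lam r x t + dTerm f lam r x t) =
      (∫ x, jTermDeriv f lam r x t) - (∫ x, dPrev f lam r x t) + ∫ x, dTerm f lam r x t := by
    rw [← integral_sub i1 i2]
    exact integral_add (i1.sub i2) i3
  rw [e1] at h
  linear_combination h

lemma integral_jTerm_sub {n : ℕ} {α : ℝ} (hα : α ≤ n) {f : ℝ → ℂ} (hf : MemT α f)
    (lam : Fin (n + 1) → ℝ) (r : ℕ) {σ a b : ℝ} (hσ : |σ| = 1) (ha : 0 < a) (hab : a ≤ b)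
    (hb : b ≤ 1) :
    (∫ x, jTerm f lam r x (σ * b)) - ∫ x, jTerm f lam r x (σ * a) =
      ∫ s in a..b, σ * ((∫ x, dPrev f lam r x (σ * s)) - ∫ x, dTerm f lam r x (σ * s)) := by
  have habs : ∀ {s}, 0 < s → |σ * s| = s := fun hs => by rw [abs_mul, hσ, one_mul, abs_of_pos hs]
  have hne : ∀ {s}, 0 < s → σ * s ≠ 0 := fun hs => by
    rw [← abs_pos, habs hs]; exact hs
  have hb0 := ha.trans_le hab
  have hbound : ∀ x, ∀ s ∈ Set.Ioc a b, ‖σ * jTermDeriv f lam r x (σ * s)‖ ≤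
      tWeight α r f x * ((2 * r + 1 + 2 * (n + 1) * a⁻¹) * (a⁻¹) ^ (n + 1)) := fun x s hs => by
    rw [norm_mul, Complex.norm_real, Real.norm_eq_abs, hσ, one_mul, mul_comm (tWeight α r f x)]
    have h := habs (ha.trans hs.1)
    exact norm_jTermDeriv_le hα f lam r ha x (h.symm ▸ hs.1.le) (h.symm ▸ hs.2.trans hb)
  have hmeas : Measurable fun p : ℝ × ℝ => σ * jTermDeriv f lam r p.1 (σ * p.2) :=
    ((measurable_jTermDeriv hf.1 lam r).comp
      (measurable_fst.prodMk (measurable_snd.const_mul σ))).const_mul _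
  have hint : Integrable (fun p : ℝ × ℝ => σ * jTermDeriv f lam r p.1 (σ * p.2))
      (volume.prod (volume.restrict (Set.Ioc a b))) := by
    refine ((hf.2 r).mul_prod (integrable_const (μ := volume.restrict (Set.Ioc a b))
      ((2 * r + 1 + 2 * (n + 1) * a⁻¹) * (a⁻¹) ^ (n + 1)))).mono' hmeas.aestronglyMeasurable ?_
    rw [← Measure.restrict_univ (μ := (volume : Measure ℝ)), Measure.prod_restrict]
    simp only [Measure.restrict_univ]
    filter_upwards [ae_restrict_mem (MeasurableSet.univ.prod measurableSet_Ioc)] with p hp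
    exact hbound p.1 p.2 hp.2
  have hftc : ∀ x, ∫ s in a..b, σ * jTermDeriv f lam r x (σ * s) =
      jTerm f lam r x (σ * b) - jTerm f lam r x (σ * a) := fun x => by
    refine intervalIntegral.integral_eq_sub_of_hasDerivAt
      (f := fun s => jTerm f lam r x (σ * s)) (fun s hs => ?_) ?_
    · rw [Set.uIcc_of_le hab] at hs
      have h1 := (hasDerivAt_jTerm f lam r x (hne (ha.trans_le hs.1))).scomp s
        ((hasDerivAt_id s).const_mul σ)
      simpa [Function.comp_def] using h1
    · rw [intervalIntegrable_iff_integrableOn_Ioc_of_le hab]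
      refine (integrable_const (μ := volume.restrict (Set.Ioc a b)) (tWeight α r f x *
        ((2 * r + 1 + 2 * (n + 1) * a⁻¹) * (a⁻¹) ^ (n + 1)))).mono'
        (hmeas.comp measurable_prodMk_left).aestronglyMeasurable ?_
      filter_upwards [ae_restrict_mem measurableSet_Ioc] with s hs using hbound x s hs
  rw [← integral_sub (integrable_jTerm hα hf lam r (hne hb0) ((habs hb0).trans_le hb))
    (integrable_jTerm hα hf lam r (hne ha) ((habs ha).trans_le (hab.trans hb)))]
  rw [← integral_congr_ae (.of_forall hftc)]
  simp only [intervalIntegral.integral_of_le hab]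
  rw [integral_integral_swap hint]
  refine setIntegral_congr_fun measurableSet_Ioc fun s hs => ?_
  have h := ha.trans hs.1
  rw [integral_const_mul, integral_jTermDeriv hα hf lam r (hne h) ((habs h).trans_le
    (hs.2.trans hb))]

/-- The `r`-th Taylor term integrated over the contour `x ↦ x + i t ⟨x⟩`. -/
def jInt {n : ℕ} (f : ℝ → ℂ) (lam : Fin (n + 1) → ℝ) (r : ℕ) (t : ℝ) : ℂ :=
  ∫ x, jTerm f lam r x t

/-- The exchanged density integrated over `x ↦ x + i t ⟨x⟩`. -/
def dInt {n : ℕ} (f : ℝ → ℂ) (lam : Fin (n + 1) → ℝ) (r : ℕ) (t : ℝ) : ℂ :=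
  ∫ x, dTerm f lam r x t

lemma norm_dInt_le {n : ℕ} {α : ℝ} (hα : α ≤ n) {f : ℝ → ℂ} (hf : MemT α f)
    (lam : Fin (n + 1) → ℝ) (r : ℕ) {t : ℝ} (ht : t ≠ 0) :
    ‖dInt f lam r t‖ ≤ |t| ^ r * (|t|⁻¹) ^ (n + 1) * TNorm α (r + 1) f := by
  rw [TNorm, ← integral_const_mul]
  exact norm_integral_le_of_norm_le ((hf.2 (r + 1)).const_mul _)
    (.of_forall fun x => norm_dTerm_le hα f lam r x ht)

lemma TNorm_nonneg (α : ℝ) (r : ℕ) (f : ℝ → ℂ) : 0 ≤ TNorm α r f :=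
  integral_nonneg fun x => tWeight_nonneg α r f x

lemma intervalIntegrable_dInt {n : ℕ} {α : ℝ} (hα : α ≤ n) {f : ℝ → ℂ} (hf : MemT α f)
    (lam : Fin (n + 1) → ℝ) (r : ℕ) {σ a b : ℝ} (hσ : |σ| = 1) (ha : 0 < a) (hab : a ≤ b)
    (hb : b ≤ 1) : IntervalIntegrable (fun s => σ * dInt f lam r (σ * s)) volume a b := by
  rw [intervalIntegrable_iff_integrableOn_Ioc_of_le hab]
  have hm : StronglyMeasurable fun s => dInt f lam r (σ * s) :=
    StronglyMeasurable.integral_prod_right' (f := fun p : ℝ × ℝ => dTerm f lam r p.2 (σ * p.1))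
      ((measurable_dTerm hf.1 lam r).comp
        (measurable_snd.prodMk (measurable_fst.const_mul σ))).stronglyMeasurable
  refine (integrable_const (μ := volume.restrict (Set.Ioc a b))
    ((a⁻¹) ^ (n + 1) * TNorm α (r + 1) f)).mono' (hm.const_mul _).aestronglyMeasurable ?_
  filter_upwards [ae_restrict_mem measurableSet_Ioc] with s hs
  have hs0 := ha.trans hs.1
  have habs : |σ * s| = s := by rw [abs_mul, hσ, one_mul, abs_of_pos hs0]
  rw [norm_mul, Complex.norm_real, Real.norm_eq_abs, hσ, one_mul]
  refine (norm_dInt_le hα hf lam r (by rw [← abs_pos, habs]; exact hs0)).trans ?_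
  have := TNorm_nonneg α (r + 1) f
  rw [habs]
  gcongr
  calc s ^ r * (s⁻¹) ^ (n + 1) ≤ 1 * (a⁻¹) ^ (n + 1) := by
        gcongr
        · exact pow_le_one₀ hs0.le (hs.2.trans hb)
        · exact hs.1.le
    _ = _ := one_mul _

lemma jInt_zero_eq {n : ℕ} {α : ℝ} (hα : α ≤ n) {f : ℝ → ℂ} (hf : MemT α f)
    (lam : Fin (n + 1) → ℝ) {σ a b : ℝ} (hσ : |σ| = 1) (ha : 0 < a) (hab : a ≤ b)
    (hb : b ≤ 1) :
    jInt f lam 0 (σ * a) =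
      jInt f lam 0 (σ * b) + ∫ s in a..b, σ * dInt f lam 0 (σ * s) := by
  have h := integral_jTerm_sub hα hf lam 0 hσ ha hab hb
  simp only [dPrev_zero, integral_zero, zero_sub, mul_neg, intervalIntegral.integral_neg] at h
  simp only [jInt, dInt]
  linear_combination -h

lemma jInt_succ_eq {n : ℕ} {α : ℝ} (hα : α ≤ n) {f : ℝ → ℂ} (hf : MemT α f)
    (lam : Fin (n + 1) → ℝ) (r : ℕ) {σ a b : ℝ} (hσ : |σ| = 1) (ha : 0 < a) (hab : a ≤ b)
    (hb : b ≤ 1) :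
    jInt f lam (r + 1) (σ * a) = jInt f lam (r + 1) (σ * b) -
      (∫ s in a..b, σ * dInt f lam r (σ * s)) +
        ∫ s in a..b, σ * dInt f lam (r + 1) (σ * s) := by
  have h := integral_jTerm_sub hα hf lam (r + 1) hσ ha hab hb
  simp only [dPrev_succ, mul_sub] at h
  have h2 := intervalIntegral.integral_sub (intervalIntegrable_dInt hα hf lam r hσ ha hab hb)
    (intervalIntegrable_dInt hα hf lam (r + 1) hσ ha hab hb)
  simp only [jInt, dInt] at h2 ⊢
  rw [h2] at h
  linear_combination -h

/-- Stopping the `r`-th Taylor term at height `ε r` when all contours move down to height `a`. -/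
lemma sum_jInt_eq {n : ℕ} {α : ℝ} (hα : α ≤ n) {f : ℝ → ℂ} (hf : MemT α f)
    (lam : Fin (n + 1) → ℝ) {σ : ℝ} (hσ : |σ| = 1) {ε : ℕ → ℝ} (hε : Antitone ε)
    (hε1 : ∀ r, ε r ≤ 1) (M : ℕ) {a : ℝ} (ha : 0 < a) (haM : a ≤ ε M) :
    ∑ r ∈ Finset.range (M + 1), jInt f lam r (σ * a) =
      ∑ r ∈ Finset.range (M + 1), jInt f lam r (σ * ε r) +
      (∑ r ∈ Finset.range M, ∫ s in ε (r + 1)..ε r, σ * dInt f lam r (σ * s)) +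
      ∫ s in a..ε M, σ * dInt f lam M (σ * s) := by
  induction M with
  | zero =>
    simp only [zero_add, Finset.range_one, Finset.sum_singleton, Finset.range_zero,
      Finset.sum_empty, add_zero]
    exact jInt_zero_eq hα hf lam hσ ha haM (hε1 0)
  | succ M ih =>
    have h1 := hε M.le_succ
    have h2 := jInt_succ_eq hα hf lam M hσ ha haM (hε1 (M + 1))
    have h3 := intervalIntegral.integral_add_adjacent_intervals
      (intervalIntegrable_dInt hα hf lam M hσ ha haM (hε1 (M + 1)))
      (intervalIntegrable_dInt hα hf lam M hσ (ha.trans_le haM) h1 (hε1 M))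
    have h4 := ih (haM.trans h1)
    rw [Finset.sum_range_succ, h4, h2, ← h3, Finset.sum_range_succ _ (M + 1),
      Finset.sum_range_succ (fun r => ∫ s in ε (r + 1)..ε r, σ * dInt f lam r (σ * s)) M]
    ring

lemma norm_integral_dInt_le {n : ℕ} {α : ℝ} (hα : α ≤ n) {f : ℝ → ℂ} (hf : MemT α f)
    (lam : Fin (n + 1) → ℝ) {σ : ℝ} (hσ : |σ| = 1) {M : ℕ} (hM : n + 1 ≤ M) {a b : ℝ}
    (ha : 0 < a) (hab : a ≤ b) (hb : b ≤ 1) :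
    ‖∫ s in a..b, σ * dInt f lam M (σ * s)‖ ≤ b * TNorm α (M + 1) f := by
  have hT := TNorm_nonneg α (M + 1) f
  have h : ∀ s ∈ Set.uIoc a b, ‖σ * dInt f lam M (σ * s)‖ ≤ TNorm α (M + 1) f := by
    intro s hs
    rw [Set.uIoc_of_le hab] at hs
    have hs0 := ha.trans hs.1
    have habs : |σ * s| = s := by rw [abs_mul, hσ, one_mul, abs_of_pos hs0]
    rw [norm_mul, Complex.norm_real, Real.norm_eq_abs, hσ, one_mul]
    refine (norm_dInt_le hα hf lam M (by rw [← abs_pos, habs]; exact hs0)).trans ?_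
    rw [habs]
    refine mul_le_of_le_one_left hT ?_
    obtain ⟨q, rfl⟩ := Nat.exists_eq_add_of_le hM
    rw [pow_add, inv_pow, mul_right_comm, mul_inv_cancel₀ (pow_ne_zero _ hs0.ne'), one_mul]
    exact pow_le_one₀ hs0.le (hs.2.trans hb)
  refine (intervalIntegral.norm_integral_le_of_norm_le_const h).trans ?_
  rw [mul_comm, abs_of_nonneg (by linarith)]
  gcongr
  linarith

lemma norm_inv_zpt_sub_le_of_le {d x l : ℝ} (hd : 0 < d) (h : d ≤ |x - l|) (t : ℝ) :
    ‖(zpt x t - l)⁻¹‖ ≤ (jb l / d + 1) * (jb x)⁻¹ := by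
  have hz := abs_sub_le_norm_zpt x t l
  have hx : 0 < |x - l| := hd.trans_le h
  have hj : jb x ≤ (jb l / d + 1) * ‖zpt x t - l‖ := by
    have h1 := jb_le_add l x
    have h2 : jb l ≤ jb l / d * |x - l| := by
      rw [div_mul_eq_mul_div, le_div_iff₀ hd]
      exact mul_le_mul_of_nonneg_left h (jb_pos l).le
    have h3 : 0 ≤ jb l / d + 1 := by have := jb_pos l; positivity
    nlinarith [mul_le_mul_of_nonneg_left hz h3]
  rw [norm_inv, inv_le_iff_one_le_mul₀ (hx.trans_le hz)]
  rw [mul_right_comm, ← div_eq_mul_inv, one_le_div (jb_pos x)]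
  exact hj

lemma norm_resProd_le_of_le {n : ℕ} (lam : Fin (n + 1) → ℝ) {d x : ℝ} (hd : 0 < d)
    (h : ∀ j, d ≤ |x - lam j|) (t : ℝ) :
    ‖resProd lam (zpt x t)‖ ≤ (∏ j, (jb (lam j) / d + 1)) * ((jb x)⁻¹) ^ (n + 1) := by
  rw [resProd, norm_prod]
  calc _ ≤ ∏ j, ((jb (lam j) / d + 1) * (jb x)⁻¹) :=
        Finset.prod_le_prod (fun _ _ => norm_nonneg _)
          fun j _ => norm_inv_zpt_sub_le_of_le hd (h j) t
    _ = _ := by simp [Finset.prod_mul_distrib]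

lemma exists_pos_le_abs_sub {n : ℕ} {lam : Fin (n + 1) → ℝ} (hlam : Function.Injective lam) :
    ∃ d : ℝ, 0 < d ∧ ∀ i j, i ≠ j → 2 * d ≤ |lam i - lam j| := by
  have h : ∀ᶠ d in 𝓝[>] (0 : ℝ), ∀ i j, i ≠ j → 2 * d ≤ |lam i - lam j| := by
    refine eventually_all.2 fun i => eventually_all.2 fun j => ?_
    by_cases hij : i = j
    · simp [hij]
    · have hc : Tendsto (fun d : ℝ => 2 * d) (𝓝[>] 0) (𝓝 (2 * 0)) :=
        (continuous_const.mul continuous_id).continuousAt.mono_left nhdsWithin_le_nhds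
      rw [mul_zero] at hc
      filter_upwards [hc.eventually_lt_const
        (abs_pos.2 (sub_ne_zero.2 (hlam.ne hij)))] with d hd _ using hd.le
  obtain ⟨d, hd, hd0⟩ := (h.and self_mem_nhdsWithin).exists
  exact ⟨d, hd0, hd⟩

/-- With distinct nodes at most one resolvent is singular, so one factor of `t` suffices. -/
lemma exists_abs_mul_norm_resProd_le {n : ℕ} {lam : Fin (n + 1) → ℝ}
    (hlam : Function.Injective lam) : ∃ C : ℝ, ∀ x t, t ≠ 0 → |t| ≤ 1 →
      |t| * ‖resProd lam (zpt x t)‖ ≤ C * ((jb x)⁻¹) ^ (n + 1) := by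
  obtain ⟨d, hd, hsep⟩ := exists_pos_le_abs_sub hlam
  refine ⟨∏ j, (jb (lam j) / d + 1), fun x t ht ht1 => ?_⟩
  have hj := jb_pos x
  by_cases hx : ∀ j, d ≤ |x - lam j|
  · exact (mul_le_of_le_one_left (norm_nonneg _) ht1).trans (norm_resProd_le_of_le lam hd hx t)
  push Not at hx
  obtain ⟨i, hi⟩ := hx
  have hfar : ∀ j, j ≠ i → d ≤ |x - lam j| := fun j hji => by
    have h1 := hsep i j hji.symm
    have h2 := abs_sub_le (lam i) x (lam j)
    rw [abs_sub_comm (lam i) x] at h2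
    linarith
  have h1 : |t| * ‖(zpt x t - lam i)⁻¹‖ ≤ (jb (lam i) / d + 1) * (jb x)⁻¹ := by
    have h2 := mul_le_mul_of_nonneg_left (norm_inv_zpt_sub_le ht x (lam i)) (abs_nonneg t)
    rw [← mul_assoc, mul_inv_cancel₀ (abs_pos.2 ht).ne'] at h2
    refine h2.trans ?_
    have := jb_pos (lam i)
    gcongr
    exact le_add_of_nonneg_left (by positivity)
  rw [resProd, norm_prod, ← Finset.mul_prod_erase _ _ (Finset.mem_univ i), ← mul_assoc]
  calc _ ≤ ((jb (lam i) / d + 1) * (jb x)⁻¹) *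
        ∏ j ∈ Finset.univ.erase i, ((jb (lam j) / d + 1) * (jb x)⁻¹) := by
        refine mul_le_mul h1 (Finset.prod_le_prod (fun _ _ => norm_nonneg _) fun j hji =>
          norm_inv_zpt_sub_le_of_le hd (hfar j (Finset.ne_of_mem_erase hji)) t)
          (Finset.prod_nonneg fun _ _ => norm_nonneg _) ?_
        have := jb_pos (lam i)
        positivity
    _ = _ := by
        rw [Finset.mul_prod_erase Finset.univ (fun j => (jb (lam j) / d + 1) * (jb x)⁻¹)
          (Finset.mem_univ i)]
        simp [Finset.prod_mul_distrib]

lemma tendsto_resProd_zpt {n : ℕ} (lam : Fin (n + 1) → ℝ) {x : ℝ} (hx : x ∉ Set.range lam) :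
    Tendsto (fun t => resProd lam (zpt x t)) (𝓝 0) (𝓝 (resProd lam (zpt x 0))) := by
  have hc : Continuous fun t => zpt x t := continuous_zpt.comp (Continuous.prodMk_right x)
  refine tendsto_finsetProd _ fun j _ => ((hc.tendsto 0).sub_const _).inv₀ fun h => hx ⟨j, ?_⟩
  have := congrArg Complex.re h
  rw [zpt_sub_re] at this
  simp only [Complex.zero_re] at this
  linarith

lemma tendsto_setIntegral_jTerm {n : ℕ} {α : ℝ} (hα : α ≤ n) {f : ℝ → ℂ} (hf : MemT α f)
    (lam : Fin (n + 1) → ℝ) (r : ℕ) {S : Set ℝ} (hS : MeasurableSet S) {C : ℝ}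
    (hC : ∀ x ∈ S, ∀ t, t ≠ 0 → |t| ≤ 1 →
      |t| ^ r * ‖resProd lam (zpt x t)‖ ≤ C * ((jb x)⁻¹) ^ (n + 1)) :
    Tendsto (fun t => ∫ x in S, jTerm f lam r x t) (𝓝[≠] 0)
      (𝓝 (∫ x in S, jTerm f lam r x 0)) := by
  refine tendsto_integral_filter_of_dominated_convergence (fun x => 2 * |C| * tWeight α r f x)
    (.of_forall fun t => ((measurable_jTerm hf.1 lam r).comp
      measurable_prodMk_right).aestronglyMeasurable) ?_ ((hf.2 r).const_mul _).integrableOn ?_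
  · have h1 : ∀ᶠ t : ℝ in 𝓝[≠] 0, |t| ≤ 1 := by
      refine nhdsWithin_le_nhds ?_
      have := (continuous_abs (G := ℝ)).tendsto 0
      rw [abs_zero] at this
      exact (this.eventually_lt_const one_pos).mono fun t ht => ht.le
    filter_upwards [h1, self_mem_nhdsWithin] with t ht1 ht
    filter_upwards [ae_restrict_mem hS] with x hx
    have hj := jb_pos x
    rw [jTerm, norm_mul, tWeight_eq]
    calc _ ≤ 2 * |t| ^ r * (‖iteratedDeriv r f x‖ * jb x ^ r) * ‖resProd lam (zpt x t)‖ := by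
          gcongr; exact norm_jCoef_le f r x ht1
      _ = 2 * (‖iteratedDeriv r f x‖ * jb x ^ r) * (|t| ^ r * ‖resProd lam (zpt x t)‖) := by ring
      _ ≤ 2 * (‖iteratedDeriv r f x‖ * jb x ^ r) * (|C| * jb x ^ (-1 - α)) := by
          refine mul_le_mul_of_nonneg_left ((hC x hx t ht ht1).trans ?_) (by positivity)
          gcongr
          · exact le_abs_self C
          · exact inv_pow_jb_le hα x
      _ = _ := by ring
  · have h1 : ∀ᵐ x : ℝ, x ∉ Set.range lam := (Set.finite_range lam).countable.ae_notMem _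
    filter_upwards [ae_restrict_of_ae h1] with x hx
    have hc : Continuous fun t => jCoef f r x t :=
      (continuous_jCoef hf.1 r).comp (Continuous.prodMk_right x)
    exact ((hc.tendsto 0).mul (tendsto_resProd_zpt lam hx)).mono_left nhdsWithin_le_nhds

lemma tendsto_jInt_zero {n : ℕ} {α : ℝ} (hα : α ≤ n) {f : ℝ → ℂ} (hf : MemT α f)
    {lam : Fin (n + 1) → ℝ} (hlam : Function.Injective lam) {r : ℕ} (hr : r ≠ 0) :
    Tendsto (jInt f lam r) (𝓝[≠] 0) (𝓝 0) := by
  obtain ⟨C, hC⟩ := exists_abs_mul_norm_resProd_le hlam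
  have h := tendsto_setIntegral_jTerm hα hf lam r MeasurableSet.univ (C := C)
    fun x _ t ht ht1 => ?_
  · have h0 : ∀ x, jTerm f lam r x 0 = 0 := fun x => by simp [jTerm, jCoef, wpt, hr]
    simp only [Measure.restrict_univ, h0, integral_zero] at h
    exact h
  · refine le_trans ?_ (hC x t ht ht1)
    gcongr
    exact pow_le_of_le_one (abs_nonneg t) ht1 hr

/-- The jump `log (z - l) - log (z̄ - l)` at `z = x + i a ⟨x⟩`. -/
def logJump (l a x : ℝ) : ℂ := Complex.log (zpt x a - l) - Complex.log (zpt x (-a) - l)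

lemma zpt_neg_sub (x a l : ℝ) :
    zpt x (-a) - l = (starRingEnd ℂ) (zpt x a - l) := by
  simp [zpt]

lemma arg_zpt_sub_ne_pi {x a l : ℝ} (ha : a ≠ 0) : (zpt x a - l).arg ≠ Real.pi := by
  intro h
  have h2 := (Complex.arg_eq_pi_iff.1 h).2
  rw [zpt_sub_im] at h2
  exact mul_ne_zero ha (jb_pos x).ne' h2

lemma logJump_eq {l a x : ℝ} (ha : a ≠ 0) :
    logJump l a x = 2 * (zpt x a - l).arg * Complex.I := by
  rw [logJump, zpt_neg_sub, Complex.log_conj _ (arg_zpt_sub_ne_pi ha), Complex.log]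
  simp only [map_add, map_mul, Complex.conj_ofReal, Complex.conj_I]
  ring

lemma norm_logJump_le {l a x : ℝ} (ha : a ≠ 0) : ‖logJump l a x‖ ≤ 2 * Real.pi := by
  rw [logJump_eq ha, norm_mul, Complex.norm_I, mul_one, norm_mul, Complex.norm_real,
    Complex.norm_ofNat, Real.norm_eq_abs]
  gcongr
  exact Complex.abs_arg_le_pi _

lemma tendsto_zpt_sub (x l : ℝ) :
    Tendsto (fun a => zpt x a - l) (𝓝[>] 0) (𝓝 ((x - l : ℝ) : ℂ)) := by
  have hc : Continuous fun t => zpt x t - l :=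
    (continuous_zpt.comp (Continuous.prodMk_right x)).sub continuous_const
  have h := hc.tendsto 0
  have e : zpt x 0 - l = ((x - l : ℝ) : ℂ) := by simp [zpt]
  rw [e] at h
  exact h.mono_left nhdsWithin_le_nhds

lemma tendsto_logJump_of_gt {l x : ℝ} (h : l < x) :
    Tendsto (fun a => logJump l a x) (𝓝[>] 0) (𝓝 0) := by
  have h1 : Tendsto (fun a => (zpt x a - l).arg) (𝓝[>] 0) (𝓝 0) := by
    have h2 : ((x - l : ℝ) : ℂ) ∈ Complex.slitPlane :=
      Complex.ofReal_mem_slitPlane.2 (sub_pos.2 h)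
    have h3 := (Complex.continuousAt_arg h2).tendsto
    rw [Complex.arg_ofReal_of_nonneg (sub_pos.2 h).le] at h3
    exact h3.comp (tendsto_zpt_sub x l)
  have h4 : Tendsto (fun a => 2 * ((zpt x a - l).arg : ℂ) * Complex.I) (𝓝[>] 0)
      (𝓝 (2 * ((0 : ℝ) : ℂ) * Complex.I)) :=
    (((Complex.continuous_ofReal.tendsto 0).comp h1).const_mul 2).mul_const _
  simp only [Complex.ofReal_zero, mul_zero, zero_mul] at h4
  refine h4.congr' ?_
  filter_upwards [self_mem_nhdsWithin] with a ha
  rw [logJump_eq (ne_of_gt ha)]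

lemma tendsto_logJump_of_lt {l x : ℝ} (h : x < l) :
    Tendsto (fun a => logJump l a x) (𝓝[>] 0) (𝓝 (2 * Real.pi * Complex.I)) := by
  have h1 : Tendsto (fun a => (zpt x a - l).arg) (𝓝[>] 0) (𝓝 Real.pi) := by
    have h3 := Complex.tendsto_arg_nhdsWithin_im_nonneg_of_re_neg_of_im_zero
      (z := ((x - l : ℝ) : ℂ)) (by simpa using h) (by simp)
    refine h3.comp (tendsto_nhdsWithin_iff.2 ⟨tendsto_zpt_sub x l, ?_⟩)
    filter_upwards [self_mem_nhdsWithin] with a ha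
    simp only [zpt_sub_im]
    exact mul_nonneg (le_of_lt ha) (jb_pos x).le
  have h4 : Tendsto (fun a => 2 * ((zpt x a - l).arg : ℂ) * Complex.I) (𝓝[>] 0)
      (𝓝 (2 * (Real.pi : ℂ) * Complex.I)) :=
    (((Complex.continuous_ofReal.tendsto _).comp h1).const_mul 2).mul_const _
  refine h4.congr' ?_
  filter_upwards [self_mem_nhdsWithin] with a ha
  rw [logJump_eq (ne_of_gt ha)]

lemma hasDerivAt_zpt (x t : ℝ) : HasDerivAt (fun x => zpt x t)
    (1 + ((t * (x / jb x) : ℝ) : ℂ) * Complex.I) x :=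
  (Complex.ofRealCLM.hasDerivAt (x := x)).add
    (hasDerivAt_ofReal_mul_I ((hasDerivAt_jb x).const_mul t))

/-- The derivative of `logJump`. -/
def logJumpDeriv (l a x : ℝ) : ℂ :=
  (1 + ((a * (x / jb x) : ℝ) : ℂ) * Complex.I) / (zpt x a - l) -
    (1 + ((-a * (x / jb x) : ℝ) : ℂ) * Complex.I) / (zpt x (-a) - l)

lemma hasDerivAt_logJump {l a : ℝ} (ha : a ≠ 0) (x : ℝ) :
    HasDerivAt (logJump l a) (logJumpDeriv l a x) x := by
  have h : ∀ b : ℝ, b ≠ 0 → HasDerivAt (fun x => Complex.log (zpt x b - l))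
      ((1 + ((b * (x / jb x) : ℝ) : ℂ) * Complex.I) / (zpt x b - l)) x := fun b hb => by
    refine HasDerivAt.clog_real ((hasDerivAt_zpt x b).sub_const (l : ℂ)) (Or.inr ?_)
    rw [zpt_sub_im]; exact mul_ne_zero hb (jb_pos x).ne'
  exact (h a ha).sub (h (-a) (neg_ne_zero.2 ha))

lemma continuous_logJumpDeriv {l a : ℝ} (ha : a ≠ 0) : Continuous (logJumpDeriv l a) := by
  have h : ∀ b : ℝ, b ≠ 0 → Continuous fun x =>
      (1 + ((b * (x / jb x) : ℝ) : ℂ) * Complex.I) / (zpt x b - l) := fun b hb =>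
    (continuous_one_add.comp (Continuous.prodMk_left b)).div
      ((continuous_zpt.comp (Continuous.prodMk_left b)).sub continuous_const)
      fun x => zpt_sub_ne_zero hb x l
  exact (h a ha).sub (h (-a) (neg_ne_zero.2 ha))

/-- The boundary values of the Cauchy kernel. -/
lemma tendsto_integral_mul_logJumpDeriv {f : ℝ → ℂ} (hf : ContDiff ℝ (⊤ : ℕ∞) f) {A l : ℝ}
    (h1 : -A < l) (h2 : l < A) :
    Tendsto (fun a => ∫ x in -A..A, f x * logJumpDeriv l a x) (𝓝[>] 0)
      (𝓝 (-(2 * Real.pi * Complex.I) * f l)) := by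
  have hd : ∀ x, HasDerivAt f (deriv f x) x := fun x =>
    (hf.differentiable (by simp) x).hasDerivAt
  have hdc : Continuous (deriv f) := hf.continuous_deriv (by exact_mod_cast le_top)
  have hlj : ∀ a : ℝ, a ≠ 0 → Continuous (logJump l a) := fun a ha =>
    continuous_iff_continuousAt.2 fun x => (hasDerivAt_logJump ha x).continuousAt
  have hpos : ∀ᶠ a : ℝ in 𝓝[>] 0, a ≠ 0 := by
    filter_upwards [self_mem_nhdsWithin] with a ha using ne_of_gt ha
  have key : ∀ (u v : ℝ) (c : ℂ), u ≤ v →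
      (∀ x ∈ Set.Ioo u v, Tendsto (fun a => logJump l a x) (𝓝[>] 0) (𝓝 c)) →
      Tendsto (fun a => ∫ x in u..v, deriv f x * logJump l a x) (𝓝[>] 0)
        (𝓝 ((f v - f u) * c)) := by
    intro u v c huv hc
    have e : (f v - f u) * c = ∫ x in u..v, deriv f x * c := by
      rw [intervalIntegral.integral_mul_const, intervalIntegral.integral_eq_sub_of_hasDerivAt
        (fun x _ => hd x) (hdc.intervalIntegrable _ _)]
    rw [e]
    refine intervalIntegral.tendsto_integral_filter_of_dominated_convergence
      (fun x => ‖deriv f x‖ * (2 * Real.pi)) ?_ ?_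
      ((hdc.norm.mul continuous_const).intervalIntegrable _ _) ?_
    · filter_upwards [hpos] with a ha using (hdc.mul (hlj a ha)).aestronglyMeasurable
    · filter_upwards [hpos] with a ha
      refine .of_forall fun x _ => ?_
      rw [norm_mul]
      gcongr
      exact norm_logJump_le ha
    · have hv : ∀ᵐ x : ℝ, x ≠ v := by simp [ae_iff]
      filter_upwards [hv] with x hx hxI
      rw [Set.uIoc_of_le huv] at hxI
      exact (hc x ⟨hxI.1, lt_of_le_of_ne hxI.2 hx⟩).const_mul _
  have k1 := key (-A) l _ h1.le fun x hx => tendsto_logJump_of_lt hx.2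
  have k2 := key l A _ h2.le fun x hx => tendsto_logJump_of_gt hx.1
  have t1 := (tendsto_logJump_of_gt h2).const_mul (f A)
  have t2 := (tendsto_logJump_of_lt h1).const_mul (f (-A))
  have tot := (t1.sub t2).sub (k1.add k2)
  have e : f A * 0 - f (-A) * (2 * Real.pi * Complex.I) -
      ((f l - f (-A)) * (2 * Real.pi * Complex.I) + (f A - f l) * 0) =
      -(2 * Real.pi * Complex.I) * f l := by ring
  rw [e] at tot
  refine tot.congr' ?_
  filter_upwards [hpos] with a ha
  rw [intervalIntegral.integral_mul_deriv_eq_deriv_mul (fun x _ => hd x)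
    (fun x _ => hasDerivAt_logJump ha x) (hdc.intervalIntegrable _ _)
    ((continuous_logJumpDeriv ha).intervalIntegrable _ _),
    intervalIntegral.integral_add_adjacent_intervals]
  all_goals exact (hdc.mul (hlj a ha)).intervalIntegrable _ _

lemma sub_mul_resProd {n : ℕ} (lam : Fin (n + 2) → ℝ) {z : ℂ} (h0 : z - lam 0 ≠ 0)
    (h1 : z - lam (Fin.last (n + 1)) ≠ 0) :
    ((lam 0 - lam (Fin.last (n + 1)) : ℝ) : ℂ) * resProd lam z =
      resProd (fun i : Fin (n + 1) => lam i.castSucc) z -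
        resProd (fun i : Fin (n + 1) => lam i.succ) z := by
  have e1 : resProd lam z = (z - lam 0)⁻¹ * resProd (fun i : Fin (n + 1) => lam i.succ) z :=
    Fin.prod_univ_succ _
  have e2 : resProd lam z =
      resProd (fun i : Fin (n + 1) => lam i.castSucc) z * (z - lam (Fin.last (n + 1)))⁻¹ :=
    Fin.prod_univ_castSucc _
  have e3 : resProd (fun i : Fin (n + 1) => lam i.succ) z = (z - lam 0) * resProd lam z := by
    rw [e1, mul_inv_cancel_left₀ h0]
  have e4 : resProd (fun i : Fin (n + 1) => lam i.castSucc) z =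
      (z - lam (Fin.last (n + 1))) * resProd lam z := by
    rw [e2, mul_comm, mul_assoc, inv_mul_cancel₀ h1, mul_one]
  rw [e3, e4]
  push_cast
  ring

lemma sub_mul_jTerm {n : ℕ} (f : ℝ → ℂ) (lam : Fin (n + 2) → ℝ) (r : ℕ) (x : ℝ) {t : ℝ}
    (ht : t ≠ 0) : ((lam 0 - lam (Fin.last (n + 1)) : ℝ) : ℂ) * jTerm f lam r x t =
      jTerm f (fun i => lam i.castSucc) r x t - jTerm f (fun i => lam i.succ) r x t := by
  rw [jTerm, mul_left_comm, sub_mul_resProd lam (zpt_sub_ne_zero ht x _)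
    (zpt_sub_ne_zero ht x _), jTerm, jTerm]
  ring

lemma continuous_jTerm {n : ℕ} {f : ℝ → ℂ} (hf : ContDiff ℝ (⊤ : ℕ∞) f)
    (lam : Fin (n + 1) → ℝ) (r : ℕ) {t : ℝ} (ht : t ≠ 0) :
    Continuous fun x => jTerm f lam r x t :=
  ((continuous_jCoef hf r).comp (Continuous.prodMk_left t)).mul <|
    continuous_finsetProd _ fun j _ =>
      ((continuous_zpt.comp (Continuous.prodMk_left t)).sub continuous_const).inv₀
        fun x => zpt_sub_ne_zero ht x (lam j)

lemma jTerm_zero_sub_eq (f : ℝ → ℂ) (lam : Fin 1 → ℝ) (x a : ℝ) :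
    jTerm f lam 0 x a - jTerm f lam 0 x (-a) = f x * logJumpDeriv (lam 0) a x := by
  have h : ∀ z, resProd lam z = (z - lam 0)⁻¹ := fun z => Fin.prod_univ_one _
  simp only [jTerm, jCoef, h, logJumpDeriv, iteratedDeriv_zero, pow_zero,
    Nat.factorial_zero, Nat.cast_one, div_eq_mul_inv, inv_one]
  ring

lemma tendsto_integral_jTerm_sub {f : ℝ → ℂ} (hf : ContDiff ℝ (⊤ : ℕ∞) f)
    {F : (m : ℕ) → (Fin (m + 1) → ℝ) → ℂ} (hF : IsDivDiff f F) (A : ℝ) (n : ℕ)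
    (lam : Fin (n + 1) → ℝ) (hlam : Function.Injective lam) (hA : ∀ j, |lam j| < A) :
    Tendsto (fun a => ∫ x in -A..A, (jTerm f lam 0 x a - jTerm f lam 0 x (-a))) (𝓝[>] 0)
      (𝓝 (-(2 * Real.pi * Complex.I) * (-1) ^ n * F n lam)) := by
  induction n with
  | zero =>
    simp only [jTerm_zero_sub_eq, pow_zero, mul_one, hF.1]
    exact tendsto_integral_mul_logJumpDeriv hf (abs_lt.1 (hA 0)).1 (abs_lt.1 (hA 0)).2
  | succ n ih =>
    have hne : lam 0 ≠ lam (Fin.last (n + 1)) := hlam.ne (Fin.last_pos.ne)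
    have hne2 : ((lam 0 - lam (Fin.last (n + 1)) : ℝ) : ℂ) ≠ 0 :=
      Complex.ofReal_ne_zero.2 (sub_ne_zero.2 hne)
    have i1 := ih (fun i => lam i.castSucc) (hlam.comp (Fin.castSucc_injective _))
      fun j => hA j.castSucc
    have i2 := ih (fun i => lam i.succ) (hlam.comp (Fin.succ_injective _)) fun j => hA j.succ
    have h := (i1.sub i2).div_const ((lam 0 - lam (Fin.last (n + 1)) : ℝ) : ℂ)
    have e : -(2 * Real.pi * Complex.I) * (-1) ^ (n + 1) * F (n + 1) lam =
        (-(2 * Real.pi * Complex.I) * (-1) ^ n * F n (fun i => lam i.castSucc) -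
          -(2 * Real.pi * Complex.I) * (-1) ^ n * F n (fun i => lam i.succ)) /
          ((lam 0 - lam (Fin.last (n + 1)) : ℝ) : ℂ) := by
      rw [hF.2.2 n lam hne, pow_succ]
      ring
    rw [e]
    refine h.congr' ?_
    filter_upwards [self_mem_nhdsWithin] with a ha
    have ha0 : a ≠ 0 := ne_of_gt ha
    have hci : ∀ (m : ℕ) (l : Fin (m + 1) → ℝ), IntervalIntegrable
        (fun x => jTerm f l 0 x a - jTerm f l 0 x (-a)) volume (-A) A := fun m l =>
      ((continuous_jTerm hf l 0 ha0).sub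
        (continuous_jTerm hf l 0 (neg_ne_zero.2 ha0))).intervalIntegrable _ _
    rw [← intervalIntegral.integral_sub (hci _ _) (hci _ _), div_eq_iff hne2, mul_comm,
      ← intervalIntegral.integral_const_mul]
    refine intervalIntegral.integral_congr fun x _ => ?_
    rw [mul_sub, sub_mul_jTerm f lam 0 x ha0, sub_mul_jTerm f lam 0 x (neg_ne_zero.2 ha0)]
    ring

lemma tendsto_jInt_zero_sub {n : ℕ} {α : ℝ} (hα : α ≤ n) {f : ℝ → ℂ} (hf : MemT α f)
    {F : (m : ℕ) → (Fin (m + 1) → ℝ) → ℂ} (hF : IsDivDiff f F)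
    {lam : Fin (n + 1) → ℝ} (hlam : Function.Injective lam) :
    Tendsto (fun a => jInt f lam 0 a - jInt f lam 0 (-a)) (𝓝[>] 0)
      (𝓝 (-(2 * Real.pi * Complex.I) * (-1) ^ n * F n lam)) := by
  set A : ℝ := ∑ j, |lam j| + 1 with hAdef
  have hA : ∀ j, |lam j| + 1 ≤ A := fun j => by
    have := Finset.single_le_sum (f := fun j => |lam j|) (fun i _ => abs_nonneg _)
      (Finset.mem_univ j)
    linarith
  have hA0 : -A ≤ A := by
    have := (abs_nonneg (lam 0)).trans (le_add_of_nonneg_right zero_le_one) |>.trans (hA 0)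
    linarith
  have h1 := tendsto_integral_jTerm_sub hf.1 hF A n lam hlam fun j => by linarith [hA j]
  have h2 := tendsto_setIntegral_jTerm hα hf lam 0 (S := (Set.Ioc (-A) A)ᶜ)
    measurableSet_Ioc.compl fun x hx t ht ht1 => by
      rw [pow_zero, one_mul]
      refine norm_resProd_le_of_le lam one_pos (fun j => ?_) t
      have hxA : A ≤ |x| := by
        by_contra! hlt
        exact hx ⟨(abs_lt.1 hlt).1, (abs_lt.1 hlt).2.le⟩
      have h3 := abs_sub_abs_le_abs_sub x (lam j)
      linarith [hA j]
  have hp : Tendsto (fun a : ℝ => a) (𝓝[>] 0) (𝓝[≠] 0) :=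
    tendsto_id.mono_left (nhdsWithin_mono _ fun a ha => ne_of_gt ha)
  have hm : Tendsto (fun a : ℝ => -a) (𝓝[>] 0) (𝓝[≠] 0) := by
    refine tendsto_nhdsWithin_iff.2 ⟨?_, ?_⟩
    · have := (continuous_neg (G := ℝ)).tendsto 0
      rw [neg_zero] at this
      exact this.mono_left nhdsWithin_le_nhds
    · filter_upwards [self_mem_nhdsWithin] with a ha using neg_ne_zero.2 (ne_of_gt ha)
  have h3 := h1.add ((h2.comp hp).sub (h2.comp hm))
  rw [sub_self, add_zero] at h3
  refine h3.congr' ?_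
  have hlt : ∀ᶠ a : ℝ in 𝓝[>] 0, a < 1 := nhdsWithin_le_nhds (Iio_mem_nhds one_pos)
  filter_upwards [self_mem_nhdsWithin, hlt] with a ha ha1
  have ha0 : (0 : ℝ) < a := ha
  have j1 := integrable_jTerm hα hf lam 0 ha0.ne' (by rw [abs_of_pos ha0]; exact ha1.le)
  have j2 := integrable_jTerm hα hf lam 0 (neg_ne_zero.2 ha0.ne')
    (by rw [abs_neg, abs_of_pos ha0]; exact ha1.le)
  rw [intervalIntegral.integral_of_le hA0, integral_sub j1.integrableOn j2.integrableOn, jInt,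
    jInt, ← integral_add_compl measurableSet_Ioc j1, ← integral_add_compl measurableSet_Ioc j2]
  simp only [Function.comp_apply]
  ring

/-- Integrability against a product with a counting measure, from summable `L¹` bounds. -/
lemma integrable_count_prod {ι Y E : Type*} [Countable ι] [MeasurableSpace ι]
    [MeasurableSingletonClass ι] [MeasurableSpace Y] {μ : Measure Y} [SigmaFinite μ]
    [NormedAddCommGroup E] {g : ι × Y → E} (hg : AEStronglyMeasurable g (Measure.count.prod μ))
    (hi : ∀ i, Integrable (fun y => g (i, y)) μ) {B : ι → ℝ} (hB : Summable B)
    (hgB : ∀ i, ∫ y, ‖g (i, y)‖ ∂μ ≤ B i) : Integrable g (Measure.count.prod μ) := by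
  rw [integrable_prod_iff hg]
  refine ⟨.of_forall hi, integrable_count_iff.2 ?_⟩
  refine hB.of_nonneg_of_le (fun i => norm_nonneg _) fun i => ?_
  rw [Real.norm_of_nonneg (integral_nonneg fun y => norm_nonneg _)]
  exact hgB i

lemma hasSum_integral_count_prod {ι Y E : Type*} [Countable ι] [MeasurableSpace ι]
    [MeasurableSingletonClass ι] [MeasurableSpace Y] {μ : Measure Y} [SigmaFinite μ]
    [NormedAddCommGroup E] [NormedSpace ℝ E] [CompleteSpace E] {g : ι × Y → E}
    (hg : Integrable g (Measure.count.prod μ)) :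
    HasSum (fun i => ∫ y, g (i, y) ∂μ) (∫ p, g p ∂(Measure.count.prod μ)) := by
  have h1 := hg.integral_prod_left
  have h2 : Summable fun i => ∫ y, g (i, y) ∂μ := (integrable_count_iff.1 h1).of_norm
  rw [integral_prod _ hg, integral_countable h1]
  simpa [Measure.real] using h2.hasSum

lemma integrable_and_integral_le_of_le_indicator {w : ℝ → ℝ} (hw : Integrable w) {a b : ℝ}
    (hab : a ≤ b) {G : ℝ × ℝ → ℝ} (hG : Measurable G) (h0 : ∀ p, 0 ≤ G p)
    (hle : ∀ p, G p ≤ w p.1 * (Set.Ioc a b).indicator 1 p.2) :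
    Integrable G ∧ ∫ p, G p ≤ (∫ x, w x) * (b - a) := by
  have hi : Integrable ((Set.Ioc a b).indicator (1 : ℝ → ℝ)) :=
    (integrable_indicator_iff measurableSet_Ioc).2 (integrableOn_const (by simp))
  have h1 := hw.mul_prod hi
  refine ⟨h1.mono' hG.aestronglyMeasurable (.of_forall fun p => ?_), ?_⟩
  · rw [Real.norm_of_nonneg (h0 p)]; exact hle p
  · refine (integral_mono_of_nonneg (.of_forall h0) h1 (.of_forall hle)).trans_eq ?_
    rw [integral_prod_mul, integral_indicator_one measurableSet_Ioc]
    simp [Measure.real, hab]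

/-- The sign attached to the upper and lower contours. -/
def bsign (b : Bool) : ℝ := if b then 1 else -1

lemma abs_bsign (b : Bool) : |bsign b| = 1 := by cases b <;> simp [bsign]

/-- The unsigned contour height: constant for Taylor terms (`true`), running over
`(ε (r + 1), ε r]` for exchanged densities (`false`). -/
def height (ε : ℕ → ℝ) (i : ℕ × Bool × Bool) (s : ℝ) : ℝ :=
  if i.2.2 = false ∧ s ∈ Set.Ioc (ε (i.1 + 1)) (ε i.1) then s else ε i.1

/-- The signed contour height. -/
def sHeight (ε : ℕ → ℝ) (ω : (ℕ × Bool × Bool) × ℝ × ℝ) : ℝ :=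
  bsign ω.1.2.1 * height ε ω.1 ω.2.2

/-- The interval of the auxiliary variable supporting a coefficient. -/
def auxSet (ε : ℕ → ℝ) (i : ℕ × Bool × Bool) : Set ℝ :=
  if i.2.2 then Set.Ioc 0 1 else Set.Ioc (ε (i.1 + 1)) (ε i.1)

/-- The coefficients of the resolvent products in the representation of the divided difference,
up to a constant. -/
def repCoef (f : ℝ → ℂ) (ε : ℕ → ℝ) (ω : (ℕ × Bool × Bool) × ℝ × ℝ) : ℂ :=
  (auxSet ε ω.1).indicator (fun _ => if ω.1.2.2 then
    bsign ω.1.2.1 * jCoef f ω.1.1 ω.2.1 (sHeight ε ω) else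
    dCoef f ω.1.1 ω.2.1 (sHeight ε ω)) ω.2.2

lemma height_mem {ε : ℕ → ℝ} (hε0 : ∀ r, 0 < ε r) (hε1 : ∀ r, ε r ≤ 1)
    (i : ℕ × Bool × Bool) (s : ℝ) : 0 < height ε i s ∧ height ε i s ≤ 1 := by
  unfold height
  split_ifs with h
  · exact ⟨(hε0 _).trans h.2.1, h.2.2.trans (hε1 _)⟩
  · exact ⟨hε0 _, hε1 _⟩

lemma abs_sHeight {ε : ℕ → ℝ} (hε0 : ∀ r, 0 < ε r) (hε1 : ∀ r, ε r ≤ 1)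
    (ω : (ℕ × Bool × Bool) × ℝ × ℝ) : |sHeight ε ω| = height ε ω.1 ω.2.2 := by
  rw [sHeight, abs_mul, abs_bsign, one_mul, abs_of_pos (height_mem hε0 hε1 _ _).1]

lemma measurable_height (ε : ℕ → ℝ) (i : ℕ × Bool × Bool) : Measurable (height ε i) := by
  unfold height
  by_cases h : i.2.2 = false
  · simp only [h, true_and]
    exact Measurable.ite measurableSet_Ioc measurable_id measurable_const
  · simp [h]

lemma measurableSet_auxSet (ε : ℕ → ℝ) (i : ℕ × Bool × Bool) : MeasurableSet (auxSet ε i) := by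
  unfold auxSet
  split_ifs <;> exact measurableSet_Ioc

lemma measurable_sHeight (ε : ℕ → ℝ) : Measurable (sHeight ε) :=
  measurable_from_prod_countable_right fun i =>
    (((measurable_height ε i).comp measurable_snd).const_mul (bsign i.2.1) :
      Measurable fun p : ℝ × ℝ => bsign i.2.1 * height ε i p.2)

lemma measurable_repCoef {f : ℝ → ℂ} (hf : ContDiff ℝ (⊤ : ℕ∞) f) (ε : ℕ → ℝ) :
    Measurable (repCoef f ε) := by
  refine measurable_from_prod_countable_right fun i => ?_
  have h1 : Measurable fun p : ℝ × ℝ => (p.1, sHeight ε (i, p)) :=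
    measurable_fst.prodMk ((measurable_sHeight ε).comp measurable_prodMk_left)
  have h2 : Measurable fun p : ℝ × ℝ => (if i.2.2 then
      bsign i.2.1 * jCoef f i.1 p.1 (sHeight ε (i, p)) else
      dCoef f i.1 p.1 (sHeight ε (i, p))) := by
    split_ifs
    · exact ((continuous_jCoef hf i.1).measurable.comp h1).const_mul _
    · exact (continuous_dCoef hf i.1).measurable.comp h1
  exact h2.indicator (measurable_snd (measurableSet_auxSet ε i))

/-- The density controlling the `S^β` seminorms with total order `m - n - 1` of the
representation. -/
def repWeight (α : ℝ) (f : ℝ → ℂ) (ε : ℕ → ℝ) (m : ℕ) (ω : (ℕ × Bool × Bool) × ℝ × ℝ) : ℝ :=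
  ‖repCoef f ε ω‖ * ((|sHeight ε ω|⁻¹) ^ m * jb ω.2.1 ^ (-1 - α))

/-- A bound for the integral of `repWeight` over each of the four pieces of index `r`. -/
def repBound (α : ℝ) (f : ℝ → ℂ) (ε : ℕ → ℝ) (m r : ℕ) : ℝ :=
  2 * ε r ^ r * ((ε r)⁻¹) ^ m * TNorm α r f +
    (if m ≤ r then 1 else ((ε (r + 1))⁻¹) ^ m) * TNorm α (r + 1) f * (ε r - ε (r + 1))

lemma measurable_repWeight (α : ℝ) {f : ℝ → ℂ} (hf : ContDiff ℝ (⊤ : ℕ∞) f) (ε : ℕ → ℝ)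
    (m : ℕ) : Measurable (repWeight α f ε m) := by
  have h : Measurable fun ω : (ℕ × Bool × Bool) × ℝ × ℝ => |sHeight ε ω| := by
    simpa only [Real.norm_eq_abs] using (measurable_sHeight ε).norm
  exact (measurable_repCoef hf ε).norm.mul ((h.inv.pow_const m).mul
    ((continuous_jb.measurable.comp (measurable_fst.comp measurable_snd)).pow_const _))

lemma repWeight_nonneg (α : ℝ) (f : ℝ → ℂ) (ε : ℕ → ℝ) (m : ℕ)
    (ω : (ℕ × Bool × Bool) × ℝ × ℝ) : 0 ≤ repWeight α f ε m ω := by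
  have := Real.rpow_nonneg (jb_pos ω.2.1).le (-1 - α)
  unfold repWeight
  positivity

lemma pow_mul_inv_pow_le {a s : ℝ} (ha : 0 < a) (has : a ≤ s) (hs : s ≤ 1) (r m : ℕ) :
    s ^ r * (s⁻¹) ^ m ≤ if m ≤ r then 1 else (a⁻¹) ^ m := by
  have hs0 := ha.trans_le has
  split_ifs with h
  · obtain ⟨q, rfl⟩ := Nat.exists_eq_add_of_le h
    have : s ^ (m + q) * (s⁻¹) ^ m = s ^ q := by
      rw [pow_add, inv_pow]
      field_simp
    rw [this]
    exact pow_le_one₀ hs0.le hs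
  · calc s ^ r * (s⁻¹) ^ m ≤ 1 * (a⁻¹) ^ m := by
          gcongr
          exact pow_le_one₀ hs0.le hs
      _ = _ := one_mul _

lemma integrable_repWeight_slice {α : ℝ} {f : ℝ → ℂ} (hf : MemT α f) {ε : ℕ → ℝ}
    (hε : Antitone ε) (hε0 : ∀ r, 0 < ε r) (hε1 : ∀ r, ε r ≤ 1) (m : ℕ)
    (i : ℕ × Bool × Bool) :
    Integrable (fun p => repWeight α f ε m (i, p)) ∧
      ∫ p, repWeight α f ε m (i, p) ≤ repBound α f ε m i.1 := by
  obtain ⟨r, σ, κ⟩ := i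
  have hm : Measurable fun p : ℝ × ℝ => repWeight α f ε m ((r, σ, κ), p) :=
    (measurable_repWeight α hf.1 ε m).comp measurable_prodMk_left
  have hle : ε (r + 1) ≤ ε r := hε (Nat.le_succ r)
  have hT := TNorm_nonneg α r f
  have hT' := TNorm_nonneg α (r + 1) f
  have hpos := hε0 r
  have hpos' := hε0 (r + 1)
  cases κ with
  | true =>
    have h := integrable_and_integral_le_of_le_indicator
      ((hf.2 r).const_mul (2 * ε r ^ r * ((ε r)⁻¹) ^ m)) zero_le_one hm
      (fun p => repWeight_nonneg _ _ _ _ _) fun p => ?_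
    · refine ⟨h.1, h.2.trans ?_⟩
      rw [integral_const_mul, repBound, ← TNorm, sub_zero, mul_one]
      refine le_add_of_nonneg_right ?_
      have : 0 ≤ ε r - ε (r + 1) := sub_nonneg.2 hle
      split_ifs <;> positivity
    · by_cases hp : p.2 ∈ Set.Ioc (0 : ℝ) 1
      · have ht : |bsign σ * ε r| = ε r := by
          rw [abs_mul, abs_bsign, one_mul, abs_of_pos hpos]
        have := norm_jCoef_mul_le α f r m p.1 (ht.trans_le (hε1 r))
        rw [ht] at this
        simpa [repWeight, repCoef, auxSet, sHeight, height, hp, ht, abs_bsign] using this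
      · simp [repWeight, repCoef, auxSet, hp]
  | false =>
    have h := integrable_and_integral_le_of_le_indicator
      ((hf.2 (r + 1)).const_mul (if m ≤ r then 1 else ((ε (r + 1))⁻¹) ^ m)) hle hm
      (fun p => repWeight_nonneg _ _ _ _ _) fun p => ?_
    · refine ⟨h.1, h.2.trans ?_⟩
      rw [integral_const_mul, repBound, ← TNorm]
      exact le_add_of_nonneg_left (by positivity)
    · by_cases hp : p.2 ∈ Set.Ioc (ε (r + 1)) (ε r)
      · have ht : |bsign σ * p.2| = p.2 := by
          rw [abs_mul, abs_bsign, one_mul, abs_of_pos (hpos'.trans hp.1)]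
        have := norm_dCoef_mul_le α f r m p.1 (bsign σ * p.2)
        rw [ht] at this
        have h2 : repWeight α f ε m ((r, σ, false), p) =
            ‖dCoef f r p.1 (bsign σ * p.2)‖ * ((p.2⁻¹) ^ m * jb p.1 ^ (-1 - α)) := by
          have hh : sHeight ε ((r, σ, false), p) = bsign σ * p.2 := by
            simp only [sHeight, height]
            rw [if_pos ⟨trivial, hp⟩]
          rw [repWeight, repCoef, hh, ht]
          simp [auxSet, hp]
        rw [h2, Set.indicator_of_mem hp, Pi.one_apply, mul_one]
        exact this.trans (mul_le_mul_of_nonneg_right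
          (pow_mul_inv_pow_le hpos' hp.1.le (hp.2.trans (hε1 r)) r m) (tWeight_nonneg _ _ _ _))
      · rw [Set.indicator_of_notMem hp]
        simp [repWeight, repCoef, auxSet, hp]

lemma integral_repCoef_true {n : ℕ} (f : ℝ → ℂ) (ε : ℕ → ℝ) (lam : Fin (n + 1) → ℝ)
    (r : ℕ) (σ : Bool) :
    ∫ p : ℝ × ℝ, repCoef f ε ((r, σ, true), p) *
      resProd lam (zpt p.1 (sHeight ε ((r, σ, true), p))) =
      bsign σ * jInt f lam r (bsign σ * ε r) := by
  have h : (fun p : ℝ × ℝ => repCoef f ε ((r, σ, true), p) *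
      resProd lam (zpt p.1 (sHeight ε ((r, σ, true), p)))) = fun p =>
      (bsign σ * jTerm f lam r p.1 (bsign σ * ε r)) *
        (Set.Ioc (0 : ℝ) 1).indicator (fun _ => (1 : ℂ)) p.2 := by
    funext p
    by_cases hp : p.2 ∈ Set.Ioc (0 : ℝ) 1
    · simp [repCoef, auxSet, sHeight, height, hp, jTerm, mul_assoc]
    · simp [repCoef, auxSet, hp]
  rw [h, Measure.volume_eq_prod, integral_prod_mul
    (f := fun x => (bsign σ : ℂ) * jTerm f lam r x (bsign σ * ε r))
    (g := (Set.Ioc (0 : ℝ) 1).indicator fun _ => (1 : ℂ)), integral_const_mul,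
    integral_indicator measurableSet_Ioc, jInt]
  simp

lemma repCoef_false_mul {n : ℕ} (f : ℝ → ℂ) (ε : ℕ → ℝ) (lam : Fin (n + 1) → ℝ)
    (r : ℕ) (σ : Bool) (p : ℝ × ℝ) :
    repCoef f ε ((r, σ, false), p) * resProd lam (zpt p.1 (sHeight ε ((r, σ, false), p))) =
      (Set.Ioc (ε (r + 1)) (ε r)).indicator (fun s => dTerm f lam r p.1 (bsign σ * s)) p.2 := by
  by_cases hp : p.2 ∈ Set.Ioc (ε (r + 1)) (ε r)
  · have hh : sHeight ε ((r, σ, false), p) = bsign σ * p.2 := by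
      simp only [sHeight, height]
      rw [if_pos ⟨trivial, hp⟩]
    rw [Set.indicator_of_mem hp, repCoef, hh]
    simp [auxSet, hp, dTerm]
  · rw [Set.indicator_of_notMem hp, repCoef]
    simp [auxSet, hp]

lemma norm_repCoef_mul_resProd_le {n : ℕ} {α : ℝ} (hα : α ≤ n) (f : ℝ → ℂ) {ε : ℕ → ℝ}
    (hε0 : ∀ r, 0 < ε r) (hε1 : ∀ r, ε r ≤ 1) (lam : Fin (n + 1) → ℝ)
    (ω : (ℕ × Bool × Bool) × ℝ × ℝ) :
    ‖repCoef f ε ω * resProd lam (zpt ω.2.1 (sHeight ε ω))‖ ≤ repWeight α f ε (n + 1) ω := by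
  rw [norm_mul]
  refine mul_le_mul_of_nonneg_left (norm_resProd_le_rpow hα lam ?_ _) (norm_nonneg _)
  rw [← abs_pos, abs_sHeight hε0 hε1]
  exact (height_mem hε0 hε1 _ _).1

lemma measurable_resProd_zpt_comp {Ω : Type*} [MeasurableSpace Ω] {n : ℕ} {X τ : Ω → ℝ}
    (hX : Measurable X) (hτ : Measurable τ) (lam : Fin (n + 1) → ℝ) :
    Measurable fun ω => resProd lam (zpt (X ω) (τ ω)) :=
  (measurable_resProd lam).comp (continuous_zpt.measurable.comp (hX.prodMk hτ))

lemma measurable_repCoef_mul_resProd {n : ℕ} {f : ℝ → ℂ} (hf : ContDiff ℝ (⊤ : ℕ∞) f)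
    (ε : ℕ → ℝ) (lam : Fin (n + 1) → ℝ) :
    Measurable fun ω : (ℕ × Bool × Bool) × ℝ × ℝ =>
      repCoef f ε ω * resProd lam (zpt ω.2.1 (sHeight ε ω)) :=
  (measurable_repCoef hf ε).mul
    (measurable_resProd_zpt_comp measurable_snd.fst (measurable_sHeight ε) lam)

lemma integral_repCoef_false {n : ℕ} {α : ℝ} (hα : α ≤ n) {f : ℝ → ℂ} (hf : MemT α f)
    {ε : ℕ → ℝ} (hε : Antitone ε) (hε0 : ∀ r, 0 < ε r) (hε1 : ∀ r, ε r ≤ 1)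
    (lam : Fin (n + 1) → ℝ) (r : ℕ) (σ : Bool) :
    ∫ p : ℝ × ℝ, repCoef f ε ((r, σ, false), p) *
      resProd lam (zpt p.1 (sHeight ε ((r, σ, false), p))) =
      ∫ s in (ε (r + 1))..(ε r), dInt f lam r (bsign σ * s) := by
  have hi : Integrable fun p : ℝ × ℝ => repCoef f ε ((r, σ, false), p) *
      resProd lam (zpt p.1 (sHeight ε ((r, σ, false), p))) :=
    (integrable_repWeight_slice hf hε hε0 hε1 (n + 1) (r, σ, false)).1.mono'
      ((measurable_repCoef_mul_resProd hf.1 ε lam).comp measurable_prodMk_left).aestronglyMeasurable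
      (.of_forall fun p => norm_repCoef_mul_resProd_le hα f hε0 hε1 lam _)
  rw [Measure.volume_eq_prod] at hi ⊢
  rw [integral_prod_symm _ hi, intervalIntegral.integral_of_le (hε (Nat.le_succ r)),
    ← integral_indicator measurableSet_Ioc]
  refine integral_congr_ae (.of_forall fun s => ?_)
  have h (x : ℝ) := repCoef_false_mul f ε lam r σ (x, s)
  simp only at h
  simp only [h]
  by_cases hs : s ∈ Set.Ioc (ε (r + 1)) (ε r)
  · simp [hs, dInt]
  · simp [hs]

/-- The total contribution of the four pieces of index `r`. -/
def repStep {n : ℕ} (f : ℝ → ℂ) (ε : ℕ → ℝ) (lam : Fin (n + 1) → ℝ) (r : ℕ) : ℂ :=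
  jInt f lam r (ε r) - jInt f lam r (-ε r) +
    ((∫ s in (ε (r + 1))..(ε r), dInt f lam r s) +
      ∫ s in (ε (r + 1))..(ε r), dInt f lam r (-s))

lemma integrable_repWeight {α : ℝ} {f : ℝ → ℂ} (hf : MemT α f) {ε : ℕ → ℝ}
    (hε : Antitone ε) (hε0 : ∀ r, 0 < ε r) (hε1 : ∀ r, ε r ≤ 1) {m : ℕ}
    (hb : Summable (repBound α f ε m)) :
    Integrable (repWeight α f ε m) (Measure.count.prod volume) ∧
      ∫ ω, repWeight α f ε m ω ∂(Measure.count.prod volume) ≤ 4 * ∑' r, repBound α f ε m r := by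
  have h0 : ∀ r, 0 ≤ repBound α f ε m r := fun r =>
    (integral_nonneg fun p => repWeight_nonneg _ _ _ _ _).trans
      (integrable_repWeight_slice hf hε hε0 hε1 m (r, true, true)).2
  have hs : HasSum (fun i : ℕ × Bool × Bool => repBound α f ε m i.1)
      (4 * ∑' r, repBound α f ε m r) := by
    have h2 : Summable fun i : ℕ × Bool × Bool => repBound α f ε m i.1 := by
      simpa using hb.mul_of_nonneg (g := fun _ : Bool × Bool => (1 : ℝ)) (Summable.of_finite)
        h0 (fun _ => zero_le_one)
    have h3 := h2.hasSum
    rw [h2.tsum_prod] at h3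
    simp only [tsum_fintype, Finset.sum_const, nsmul_eq_mul, tsum_mul_left] at h3
    simpa using h3
  have hi : Integrable (repWeight α f ε m) (Measure.count.prod volume) := by
    refine integrable_count_prod (measurable_repWeight α hf.1 ε m).aestronglyMeasurable
      (fun i => (integrable_repWeight_slice hf hε hε0 hε1 m i).1) hs.summable fun i => ?_
    simp only [Real.norm_of_nonneg (repWeight_nonneg _ _ _ _ _)]
    exact (integrable_repWeight_slice hf hε hε0 hε1 m i).2
  exact ⟨hi, hasSum_le (fun i => (integrable_repWeight_slice hf hε hε0 hε1 m i).2)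
    (hasSum_integral_count_prod hi) hs⟩

lemma hasSum_repStep {n : ℕ} {α : ℝ} (hα : α ≤ n) {f : ℝ → ℂ} (hf : MemT α f)
    {ε : ℕ → ℝ} (hε : Antitone ε) (hε0 : ∀ r, 0 < ε r) (hε1 : ∀ r, ε r ≤ 1)
    (hb : Summable (repBound α f ε (n + 1))) (lam : Fin (n + 1) → ℝ) :
    HasSum (repStep f ε lam)
      (∫ ω, repCoef f ε ω * resProd lam (zpt ω.2.1 (sHeight ε ω))
        ∂(Measure.count.prod volume)) := by
  have hi := (integrable_repWeight hf hε hε0 hε1 hb).1.mono'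
    (measurable_repCoef_mul_resProd hf.1 ε lam).aestronglyMeasurable
    (.of_forall fun ω => norm_repCoef_mul_resProd_le hα f hε0 hε1 lam ω)
  refine (hasSum_integral_count_prod hi).prod_fiberwise fun r => ?_
  have h := hasSum_fintype fun j : Bool × Bool => ∫ p : ℝ × ℝ, repCoef f ε ((r, j), p) *
    resProd lam (zpt p.1 (sHeight ε ((r, j), p)))
  suffices repStep f ε lam r = ∑ j : Bool × Bool, ∫ p : ℝ × ℝ, repCoef f ε ((r, j), p) *
      resProd lam (zpt p.1 (sHeight ε ((r, j), p))) from this ▸ h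
  rw [Fintype.sum_prod_type]
  simp only [Fintype.sum_bool, integral_repCoef_true, integral_repCoef_false hα hf hε hε0 hε1,
    repStep, bsign]
  simp
  ring

lemma norm_jInt_le {n : ℕ} {α : ℝ} (hα : α ≤ n) {f : ℝ → ℂ} (hf : MemT α f)
    (lam : Fin (n + 1) → ℝ) (r : ℕ) {t : ℝ} (ht : t ≠ 0) (ht1 : |t| ≤ 1) :
    ‖jInt f lam r t‖ ≤ 2 * |t| ^ r * (|t|⁻¹) ^ (n + 1) * TNorm α r f := by
  rw [TNorm, ← integral_const_mul]
  exact norm_integral_le_of_norm_le ((hf.2 r).const_mul _)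
    (.of_forall fun x => norm_jTerm_le hα f lam r x ht ht1)

lemma tendsto_sum_jInt_sub {n : ℕ} {α : ℝ} (hα : α ≤ n) {f : ℝ → ℂ} (hf : MemT α f)
    {F : (m : ℕ) → (Fin (m + 1) → ℝ) → ℂ} (hF : IsDivDiff f F)
    {lam : Fin (n + 1) → ℝ} (hlam : Function.Injective lam) (M : ℕ) :
    Tendsto (fun a => ∑ r ∈ Finset.range (M + 1), (jInt f lam r a - jInt f lam r (-a)))
      (𝓝[>] 0) (𝓝 (-(2 * Real.pi * Complex.I) * (-1) ^ n * F n lam)) := by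
  have hp : Tendsto (fun a : ℝ => a) (𝓝[>] 0) (𝓝[≠] 0) :=
    tendsto_id.mono_left (nhdsWithin_mono _ fun a ha => ne_of_gt ha)
  have hm : Tendsto (fun a : ℝ => -a) (𝓝[>] 0) (𝓝[≠] 0) := by
    refine tendsto_nhdsWithin_iff.2 ⟨?_, ?_⟩
    · have := (continuous_neg (G := ℝ)).tendsto 0
      rw [neg_zero] at this
      exact this.mono_left nhdsWithin_le_nhds
    · filter_upwards [self_mem_nhdsWithin] with a ha
      exact neg_ne_zero.2 (ne_of_gt ha)
  simp only [Finset.sum_range_succ']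
  have h : Tendsto (fun a => ∑ r ∈ Finset.range M,
      (jInt f lam (r + 1) a - jInt f lam (r + 1) (-a))) (𝓝[>] 0) (𝓝 0) := by
    have h1 : Tendsto (fun a => ∑ r ∈ Finset.range M,
        (jInt f lam (r + 1) a - jInt f lam (r + 1) (-a))) (𝓝[>] 0)
        (𝓝 (∑ r ∈ Finset.range M, (0 : ℂ))) := by
      refine tendsto_finsetSum _ fun r _ => ?_
      have h0 := tendsto_jInt_zero hα hf hlam r.succ_ne_zero
      rw [← sub_zero (0 : ℂ)]
      exact (h0.comp hp).sub (h0.comp hm)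
    rwa [Finset.sum_const_zero] at h1
  simpa using h.add (tendsto_jInt_zero_sub hα hf hF hlam)

/-- The partial sums of `repStep` approximate the contour value of the divided difference. -/
lemma norm_sum_repStep_sub_le {n : ℕ} {α : ℝ} (hα : α ≤ n) {f : ℝ → ℂ} (hf : MemT α f)
    {F : (m : ℕ) → (Fin (m + 1) → ℝ) → ℂ} (hF : IsDivDiff f F)
    {lam : Fin (n + 1) → ℝ} (hlam : Function.Injective lam) {ε : ℕ → ℝ} (hε : Antitone ε)
    (hε0 : ∀ r, 0 < ε r) (hε1 : ∀ r, ε r ≤ 1) {M : ℕ} (hM : n + 2 ≤ M) :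
    ‖∑ r ∈ Finset.range M, repStep f ε lam r - -(2 * Real.pi * Complex.I) * (-1) ^ n * F n lam‖ ≤
      4 * (ε M * TNorm α M f) + 2 * (ε M * TNorm α (M + 1) f) := by
  set L := -(2 * Real.pi * Complex.I) * (-1) ^ n * F n lam
  have hlim := ((tendsto_sum_jInt_sub hα hf hF hlam M).const_sub
    (∑ r ∈ Finset.range M, repStep f ε lam r + (jInt f lam M (ε M) - jInt f lam M (-ε M)))).norm
  have h1 : ‖∑ r ∈ Finset.range M, repStep f ε lam r +
      (jInt f lam M (ε M) - jInt f lam M (-ε M)) - L‖ ≤ 2 * (ε M * TNorm α (M + 1) f) := by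
    refine le_of_tendsto hlim ?_
    filter_upwards [Ioc_mem_nhdsGT (hε0 M)] with a ha
    have hpos := sum_jInt_eq hα hf lam (abs_one (α := ℝ)) hε hε1 M ha.1 ha.2
    have hneg := sum_jInt_eq hα hf lam (σ := -1) (by simp) hε hε1 M ha.1 ha.2
    have bpos := norm_integral_dInt_le hα hf lam (abs_one (α := ℝ)) (by omega : n + 1 ≤ M) ha.1
      ha.2 (hε1 M)
    have bneg := norm_integral_dInt_le hα hf lam (σ := -1) (by simp) (by omega : n + 1 ≤ M) ha.1
      ha.2 (hε1 M)
    set R := ∫ s in a..ε M, ((1 : ℝ) : ℂ) * dInt f lam M (1 * s)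
    set R' := ∫ s in a..ε M, ((-1 : ℝ) : ℂ) * dInt f lam M (-1 * s)
    have h2 : ∑ r ∈ Finset.range M, repStep f ε lam r +
        (jInt f lam M (ε M) - jInt f lam M (-ε M)) -
        ∑ r ∈ Finset.range (M + 1), (jInt f lam r a - jInt f lam r (-a)) = R' - R := by
      simp only [one_mul, Complex.ofReal_one, Complex.ofReal_neg, neg_mul,
        intervalIntegral.integral_neg, Finset.sum_neg_distrib] at hpos hneg
      rw [Finset.sum_sub_distrib, hpos, hneg]
      simp only [repStep, Finset.sum_add_distrib, Finset.sum_sub_distrib, Finset.sum_range_succ]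
      ring
    rw [h2]
    refine (norm_sub_le _ _).trans ?_
    linarith
  have h3 : ∀ t, |t| = ε M → ‖jInt f lam M t‖ ≤ 2 * (ε M * TNorm α M f) := fun t ht => by
    have hT := TNorm_nonneg α M f
    have h4 := norm_jInt_le hα hf lam M (t := t) (by rw [← abs_pos, ht]; exact hε0 M)
      (ht.trans_le (hε1 M))
    rw [ht] at h4
    refine h4.trans ?_
    have h5 : ε M ^ M * ((ε M)⁻¹) ^ (n + 1) ≤ ε M := by
      have h0 := hε0 M
      obtain ⟨q, rfl⟩ := Nat.exists_eq_add_of_le hM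
      have : ε (n + 2 + q) ^ (n + 2 + q) * ((ε (n + 2 + q))⁻¹) ^ (n + 1) =
          ε (n + 2 + q) * ε (n + 2 + q) ^ q := by
        rw [inv_pow]
        field_simp
        ring
      rw [this]
      exact mul_le_of_le_one_right h0.le (pow_le_one₀ h0.le (hε1 _))
    nlinarith [mul_le_mul_of_nonneg_right h5 hT]
  have h6 := h3 (ε M) (abs_of_pos (hε0 M))
  have h7 := h3 (-ε M) (by rw [abs_neg, abs_of_pos (hε0 M)])
  calc _ = ‖(∑ r ∈ Finset.range M, repStep f ε lam r +
        (jInt f lam M (ε M) - jInt f lam M (-ε M)) - L) -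
        jInt f lam M (ε M) + jInt f lam M (-ε M)‖ := by congr 1; ring
    _ ≤ _ := (norm_add_le _ _).trans (add_le_add (norm_sub_le _ _) le_rfl)
    _ ≤ _ := by linarith

lemma mem_closure_injective {n : ℕ} (lam : Fin (n + 1) → ℝ) :
    lam ∈ closure {x : Fin (n + 1) → ℝ | Function.Injective x} := by
  have hc : Continuous fun (t : ℝ) (i : Fin (n + 1)) => lam i + t * (i : ℝ) := by fun_prop
  have ht : Tendsto (fun (t : ℝ) (i : Fin (n + 1)) => lam i + t * (i : ℝ)) (𝓝[≠] 0) (𝓝 lam) := by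
    have := hc.tendsto 0
    simp only [zero_mul, add_zero] at this
    exact this.mono_left nhdsWithin_le_nhds
  refine mem_closure_of_tendsto ht ?_
  have hfin : Set.Finite {t : ℝ | ∃ i j : Fin (n + 1), i ≠ j ∧
      lam i + t * (i : ℝ) = lam j + t * (j : ℝ)} := by
    refine (Set.finite_range fun p : Fin (n + 1) × Fin (n + 1) =>
      (lam p.2 - lam p.1) / ((p.1 : ℝ) - (p.2 : ℝ))).subset ?_
    rintro t ⟨i, j, hij, h⟩
    refine ⟨(i, j), ?_⟩
    have : ((i : ℝ) - (j : ℝ)) ≠ 0 := by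
      rw [sub_ne_zero]
      exact_mod_cast fun h => hij (Fin.ext h)
    simp only
    rw [div_eq_iff this]
    linear_combination -h
  have h3 : ∀ᶠ t in 𝓝[≠] (0 : ℝ), t ∉ {t : ℝ | ∃ i j : Fin (n + 1), i ≠ j ∧
      lam i + t * (i : ℝ) = lam j + t * (j : ℝ)} :=
    nhdsNE_le_cofinite 0 hfin.compl_mem_cofinite
  filter_upwards [h3] with t ht i j hij
  by_contra hne
  exact ht ⟨i, j, hne, hij⟩

/-- The divided difference is a superposition of products of resolvents. -/
theorem integral_repCoef_mul_resProd {n : ℕ} {α : ℝ} (hα : α ≤ n) {f : ℝ → ℂ} (hf : MemT α f)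
    {F : (m : ℕ) → (Fin (m + 1) → ℝ) → ℂ} (hF : IsDivDiff f F) {ε : ℕ → ℝ} (hε : Antitone ε)
    (hε0 : ∀ r, 0 < ε r) (hε1 : ∀ r, ε r ≤ 1)
    (hb : Summable (repBound α f ε (n + 1)))
    (h1 : Tendsto (fun r => ε r * TNorm α r f) atTop (𝓝 0))
    (h2 : Tendsto (fun r => ε r * TNorm α (r + 1) f) atTop (𝓝 0)) (lam : Fin (n + 1) → ℝ) :
    ∫ ω, repCoef f ε ω * resProd lam (zpt ω.2.1 (sHeight ε ω)) ∂(Measure.count.prod volume) =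
      -(2 * Real.pi * Complex.I) * (-1) ^ n * F n lam := by
  have hinj : ∀ lam : Fin (n + 1) → ℝ, Function.Injective lam →
      ∫ ω, repCoef f ε ω * resProd lam (zpt ω.2.1 (sHeight ε ω)) ∂(Measure.count.prod volume) =
        -(2 * Real.pi * Complex.I) * (-1) ^ n * F n lam := fun lam hlam => by
    refine tendsto_nhds_unique (hasSum_repStep hα hf hε hε0 hε1 hb lam).tendsto_sum_nat ?_
    rw [tendsto_iff_norm_sub_tendsto_zero]
    refine squeeze_zero' (.of_forall fun _ => norm_nonneg _) ?_
      (by simpa using (h1.const_mul 4).add (h2.const_mul 2))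
    filter_upwards [eventually_ge_atTop (n + 2)] with M hM
    exact norm_sum_repStep_sub_le hα hf hF hlam hε hε0 hε1 hM
  have hc : Continuous fun lam : Fin (n + 1) → ℝ =>
      ∫ ω, repCoef f ε ω * resProd lam (zpt ω.2.1 (sHeight ε ω)) ∂(Measure.count.prod volume) :=
    continuous_integral_resProd hα (measurable_repCoef hf.1 ε) measurable_snd.fst
      (measurable_sHeight ε) (fun ω => by
        rw [← abs_pos, abs_sHeight hε0 hε1]
        exact (height_mem hε0 hε1 _ _).1) (integrable_repWeight hf hε hε0 hε1 hb).1
  have hclosed := isClosed_eq hc ((hF.2.1 n).const_mul (-(2 * Real.pi * Complex.I) * (-1) ^ n))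
  exact hclosed.closure_subset_iff.2 (fun lam h => hinj lam h) (mem_closure_injective lam)

/-- Heights equal to `1` up to index `N` and then decaying as fast as needed to absorb `T`. -/
lemma exists_heights {T : ℕ → ℝ} (hT : ∀ r, 0 ≤ T r) (N : ℕ) {δ : ℝ} (hδ : 0 < δ)
    (hδ1 : δ ≤ 1) :
    ∃ ε : ℕ → ℝ, Antitone ε ∧ (∀ r, 0 < ε r) ∧ (∀ r, ε r ≤ 1) ∧ (∀ r ≤ N, ε r = 1) ∧
      ∀ r, N < r → ε r * T r ≤ δ * (1 / 2) ^ r ∧ ε r * T (r + 1) ≤ δ * (1 / 2) ^ r := by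
  set S : ℕ → ℝ := fun r => 1 + ∑ q ∈ Finset.range (r + 2), T q with hS
  have hS1 : ∀ r, 1 ≤ S r := fun r =>
    le_add_of_nonneg_right (Finset.sum_nonneg fun q _ => hT q)
  have hSmono : Monotone S := fun r s hrs => by
    simp only [hS]
    gcongr 1 + ?_
    exact Finset.sum_le_sum_of_subset_of_nonneg
      (Finset.range_subset_range.2 (by omega)) fun q _ _ => hT q
  have hTS : ∀ r q, q < r + 2 → T q ≤ S r := fun r q hq =>
    (Finset.single_le_sum (f := T) (fun q _ => hT q) (Finset.mem_range.2 hq)).trans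
      (le_add_of_nonneg_left zero_le_one)
  set g : ℕ → ℝ := fun r => δ * (1 / 2) ^ r / S r with hg
  have hg0 : ∀ r, 0 < g r := fun r => by
    have := hS1 r
    simp only [hg]
    positivity
  have hg1 : ∀ r, g r ≤ 1 := fun r => by
    have h1 : (1 / 2 : ℝ) ^ r ≤ 1 := pow_le_one₀ (by norm_num) (by norm_num)
    exact div_le_one_of_le₀ ((mul_le_one₀ hδ1 (by positivity) h1).trans (hS1 r))
      (zero_le_one.trans (hS1 r))
  have hganti : Antitone g := fun r s hrs => by
    have h1 := hS1 r
    simp only [hg]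
    gcongr δ * ?_ / ?_
    · exact pow_le_pow_of_le_one (by norm_num) (by norm_num) hrs
    · exact hSmono hrs
  have hgT : ∀ r q, q < r + 2 → g r * T q ≤ δ * (1 / 2) ^ r := fun r q hq => by
    have h1 := hS1 r
    calc g r * T q ≤ g r * S r := mul_le_mul_of_nonneg_left (hTS r q hq) (hg0 r).le
      _ = _ := by simp only [hg]; field_simp
  refine ⟨fun r => if r ≤ N then 1 else g r, fun r s hrs => ?_, fun r => ?_, fun r => ?_,
    fun r hr => if_pos hr, fun r hr => ?_⟩
  · simp only
    split_ifs with h1 h2 h2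
    · exact le_rfl
    · omega
    · exact hg1 s
    · exact hganti hrs
  · simp only
    split_ifs
    · exact zero_lt_one
    · exact hg0 r
  · simp only
    split_ifs
    · exact le_rfl
    · exact hg1 r
  · simp only [if_neg (not_le.2 hr)]
    exact ⟨hgT r r (by omega), hgT r (r + 1) (by omega)⟩

lemma repBound_nonneg (α : ℝ) (f : ℝ → ℂ) {ε : ℕ → ℝ} (hε : Antitone ε) (hε0 : ∀ r, 0 < ε r)
    (m r : ℕ) : 0 ≤ repBound α f ε m r := by
  have h1 := hε0 r
  have h2 := hε0 (r + 1)
  have h3 : 0 ≤ ε r - ε (r + 1) := sub_nonneg.2 (hε (Nat.le_succ r))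
  have h4 := TNorm_nonneg α r f
  have h5 := TNorm_nonneg α (r + 1) f
  unfold repBound
  split_ifs <;> positivity

lemma repBound_le_of_lt (α : ℝ) (f : ℝ → ℂ) {ε : ℕ → ℝ} (hε0 : ∀ r, 0 < ε r)
    (hε1 : ∀ r, ε r ≤ 1) {m r : ℕ} (hmr : m < r) :
    repBound α f ε m r ≤ 2 * (ε r * TNorm α r f) + ε r * TNorm α (r + 1) f := by
  have h1 := hε0 r
  have h2 := hε0 (r + 1)
  have h4 := TNorm_nonneg α r f
  have h5 := TNorm_nonneg α (r + 1) f
  have h6 : ε r ^ r * ((ε r)⁻¹) ^ m ≤ ε r := by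
    obtain ⟨q, rfl⟩ := Nat.exists_eq_add_of_lt hmr
    have : ε (m + q + 1) ^ (m + q + 1) * ((ε (m + q + 1))⁻¹) ^ m =
        ε (m + q + 1) * ε (m + q + 1) ^ q := by
      rw [inv_pow]
      field_simp
      ring
    rw [this]
    exact mul_le_of_le_one_right h1.le (pow_le_one₀ h1.le (hε1 _))
  rw [repBound, if_pos hmr.le]
  nlinarith [mul_le_mul_of_nonneg_right h6 h4, mul_nonneg h2.le h5]

lemma summable_repBound {α : ℝ} {f : ℝ → ℂ} {ε : ℕ → ℝ} (hε : Antitone ε) (hε0 : ∀ r, 0 < ε r)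
    (hε1 : ∀ r, ε r ≤ 1) {N : ℕ} {δ : ℝ}
    (h : ∀ r, N < r → ε r * TNorm α r f ≤ δ * (1 / 2) ^ r ∧
      ε r * TNorm α (r + 1) f ≤ δ * (1 / 2) ^ r) (m : ℕ) : Summable (repBound α f ε m) := by
  rw [← summable_nat_add_iff (N + m + 1)]
  refine Summable.of_nonneg_of_le (fun r => repBound_nonneg α f hε hε0 m _) (fun r => ?_)
    ((summable_nat_add_iff (N + m + 1)).2 (summable_geometric_two.mul_left (3 * δ)))
  have h1 := h (r + (N + m + 1)) (by omega)
  have h2 := repBound_le_of_lt α f hε0 hε1 (show m < r + (N + m + 1) by omega)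
  linarith

lemma tsum_repBound_le {α : ℝ} {f : ℝ → ℂ} {ε : ℕ → ℝ} (hε : Antitone ε) (hε0 : ∀ r, 0 < ε r)
    (hε1 : ∀ r, ε r ≤ 1) {N : ℕ} (hN : ∀ r ≤ N, ε r = 1) {δ : ℝ} (hδ : 0 < δ)
    (h : ∀ r, N < r → ε r * TNorm α r f ≤ δ * (1 / 2) ^ r ∧
      ε r * TNorm α (r + 1) f ≤ δ * (1 / 2) ^ r) :
    ∑' r, repBound α f ε N r ≤ 3 * ∑ r ∈ Finset.range (N + 2), TNorm α r f + 6 * δ := by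
  have hs := summable_repBound hε hε0 hε1 h N
  have h1 : ∀ r ∈ Finset.range (N + 1), repBound α f ε N r ≤
      2 * TNorm α r f + TNorm α (r + 1) f := fun r hr => by
    have hrN : r ≤ N := Nat.lt_succ_iff.1 (Finset.mem_range.1 hr)
    have h5 := TNorm_nonneg α (r + 1) f
    rw [repBound, hN r hrN]
    rcases hrN.lt_or_eq with hlt | rfl
    · rw [hN (r + 1) hlt]
      simpa using h5
    · rw [if_pos le_rfl]
      simp only [one_pow, inv_one, mul_one, one_mul]
      nlinarith [mul_nonneg h5 (hε0 (r + 1)).le]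
  have h2 : ∑ r ∈ Finset.range (N + 1), repBound α f ε N r ≤
      3 * ∑ r ∈ Finset.range (N + 2), TNorm α r f := by
    refine (Finset.sum_le_sum h1).trans ?_
    rw [Finset.sum_add_distrib, ← Finset.mul_sum]
    have h3 := Finset.sum_range_succ (fun r => TNorm α r f) (N + 1)
    have h4 := Finset.sum_range_succ' (fun r => TNorm α r f) (N + 1)
    have h5 := TNorm_nonneg α 0 f
    have h6 := TNorm_nonneg α (N + 1) f
    linarith
  have hg := summable_geometric_two.mul_left (3 * δ)
  have h3 : ∑' r, repBound α f ε N (r + (N + 1)) ≤ ∑' r, 3 * δ * (1 / 2 : ℝ) ^ r := by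
    refine ((summable_nat_add_iff (N + 1)).2 hs).tsum_le_tsum (fun r => ?_) hg
    have h4 := h (r + (N + 1)) (by omega)
    have h5 := repBound_le_of_lt α f hε0 hε1 (show N < r + (N + 1) by omega)
    have h6 : (1 / 2 : ℝ) ^ (r + (N + 1)) ≤ (1 / 2) ^ r :=
      pow_le_pow_of_le_one (by norm_num) (by norm_num) (by omega)
    nlinarith [mul_le_mul_of_nonneg_left h6 hδ.le]
  rw [tsum_mul_left, tsum_geometric_two] at h3
  rw [← hs.sum_add_tsum_nat_add (N + 1)]
  linarith

/-- A box representation of the divided difference, whose cost for the seminorm of orders `k` is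
controlled by the `T^α` seminorms of `f` up to an arbitrarily small error. -/
theorem exists_isBoxRep {n : ℕ} {α : ℝ} (hα : α ≤ n) {β : Fin (n + 1) → ℝ}
    (hβ : ∀ j, -1 ≤ β j ∧ β j ≤ 0) (hsum : ∑ j, β j = α - n) (k : Fin (n + 1) → ℕ)
    {f : ℝ → ℂ} (hf : MemT α f) {F : (m : ℕ) → (Fin (m + 1) → ℝ) → ℂ} (hF : IsDivDiff f F)
    {δ : ℝ} (hδ : 0 < δ) (hδ1 : δ ≤ 1) :
    ∃ (Ω : Type) (mΩ : MeasurableSpace Ω) (ν : Measure Ω) (a : Fin (n + 1) → ℝ → Ω → ℂ),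
      IsBoxRep β (F n) Ω mΩ ν a ∧
      ∫⁻ ω, ∏ j, ENNReal.ofReal (SNorm (β j) (k j) (fun x => a j x ω)) ∂ν ≤
        ENNReal.ofReal ((∏ j, ((k j).factorial * 2 ^ (k j + 1) : ℝ)) *
          (4 * (3 * ∑ r ∈ Finset.range (n + (∑ j, k j) + 3), TNorm α r f + 6 * δ))) := by
  obtain ⟨ε, hε, hε0, hε1, hN, hεT⟩ := exists_heights (fun r => TNorm_nonneg α r f)
    ((∑ j, k j) + n + 1) hδ hδ1
  have hb := summable_repBound hε hε0 hε1 hεT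
  have hgeo : Tendsto (fun r : ℕ => δ * (1 / 2 : ℝ) ^ r) atTop (𝓝 0) := by
    simpa using (tendsto_pow_atTop_nhds_zero_of_lt_one (by norm_num : (0 : ℝ) ≤ 1 / 2)
      (by norm_num)).const_mul δ
  have hrep := integral_repCoef_mul_resProd hα hf hF hε hε0 hε1 (hb _)
    (squeeze_zero' (.of_forall fun r => mul_nonneg (hε0 r).le (TNorm_nonneg _ _ _))
      ((eventually_gt_atTop _).mono fun r hr => (hεT r hr).1) hgeo)
    (squeeze_zero' (.of_forall fun r => mul_nonneg (hε0 r).le (TNorm_nonneg _ _ _))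
      ((eventually_gt_atTop _).mono fun r hr => (hεT r hr).2) hgeo)
  set κ : ℂ := (-(2 * Real.pi * Complex.I) * (-1) ^ n)⁻¹ with hκ
  have hκ0 : -(2 * Real.pi * Complex.I) * (-1) ^ n ≠ 0 := by simp [Real.pi_ne_zero]
  have hκ1 : ‖κ‖ ≤ 1 := by
    have : 1 ≤ |Real.pi| := by rw [abs_of_pos Real.pi_pos]; linarith [Real.pi_gt_three]
    rw [hκ, norm_inv]
    refine inv_le_one_of_one_le₀ ?_
    simp
    linarith
  have hτ0 : ∀ ω, sHeight ε ω ≠ 0 := fun ω => by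
    rw [← abs_pos, abs_sHeight hε0 hε1]
    exact (height_mem hε0 hε1 _ _).1
  have hτ1 : ∀ ω, |sHeight ε ω| ≤ 1 := fun ω =>
    (abs_sHeight hε0 hε1 ω).trans_le (height_mem hε0 hε1 _ _).2
  have hw : ∀ m ω, ‖κ * repCoef f ε ω‖ * ((|sHeight ε ω|⁻¹) ^ m * jb ω.2.1 ^ (-1 - α)) ≤
      repWeight α f ε m ω := fun m ω => by
    have := repWeight_nonneg α f ε m ω
    rw [norm_mul, mul_assoc]
    exact mul_le_of_le_one_left this hκ1
  have hw' : ∀ m ω, ‖κ * repCoef f ε ω‖ * ((|sHeight ε ω|⁻¹) ^ m * jb ω.2.1 ^ (-1 - α)) =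
      ‖κ‖ * repWeight α f ε m ω := fun m ω => by rw [norm_mul, mul_assoc, repWeight]
  refine ⟨(ℕ × Bool × Bool) × ℝ × ℝ, inferInstance, Measure.count.prod volume,
    resFactor (fun ω => κ * repCoef f ε ω) (fun ω => ω.2.1) (sHeight ε),
    isBoxRep_resFactor hβ hsum ((measurable_repCoef hf.1 ε).const_mul κ) measurable_snd.fst
      (measurable_sHeight ε) hτ0 hτ1 (fun K => ?_) fun lam => ?_,
    (lintegral_prod_SNorm_resFactor_le hβ hsum _ hτ0 hτ1 k).trans ?_⟩
  · simp only [hw']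
    exact (integrable_repWeight hf hε hε0 hε1 (hb _)).1.const_mul _
  · simp only [mul_assoc κ]
    rw [integral_const_mul, hrep lam, hκ, inv_mul_cancel_left₀ hκ0]
  · rw [ENNReal.ofReal_mul (by positivity)]
    gcongr
    obtain ⟨hi, hle⟩ := integrable_repWeight hf hε hε0 hε1 (hb ((∑ j, k j) + n + 1))
    refine (lintegral_mono fun ω => ENNReal.ofReal_le_ofReal (hw _ ω)).trans ?_
    rw [← ofReal_integral_eq_lintegral_ofReal hi
      (.of_forall fun ω => repWeight_nonneg _ _ _ _ ω)]
    refine ENNReal.ofReal_le_ofReal (hle.trans ?_)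
    have := tsum_repBound_le hε hε0 hε1 hN hδ hεT
    rw [show n + (∑ j, k j) + 3 = (∑ j, k j) + n + 1 + 2 by ring]
    linarith

end

open scoped ENNReal in
/-- Let `n ≥ 0`, `−1 ≤ α ≤ n`, and `β_0, …, β_n ∈ [−1, 0]` with
`Σ β_j = α − n`. If `f ∈ T^α(ℝ)` then the divided difference `f^{[n]}` belongs to
`S^{β_0}(ℝ) ⊠ᵢ ⋯ ⊠ᵢ S^{β_n}(ℝ)`, and for all `k_0, …, k_n ≥ 0` there is a constant `C`
independent of `f` with `‖f^{[n]}‖_{k_0,…,k_n} ≤ C · Σ_{r=0}^{n+k_0+⋯+k_n+2} ‖f‖_{T^α,r}`. -/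
theorem stmt4 (n : ℕ) (α : ℝ) (hα₁ : -1 ≤ α) (hα₂ : α ≤ (n : ℝ))
    (β : Fin (n + 1) → ℝ) (hβ : ∀ j, -1 ≤ β j ∧ β j ≤ 0)
    (hsum : ∑ j, β j = α - n) (k : Fin (n + 1) → ℕ) :
    ∃ C : ℝ, 0 ≤ C ∧
      ∀ (f : ℝ → ℂ) (F : (m : ℕ) → (Fin (m + 1) → ℝ) → ℂ),
        MemT α f → IsDivDiff f F →
        MemBox β (F n) ∧
        boxNorm β k (F n) ≤
          ENNReal.ofReal (C * ∑ r ∈ Finset.range (n + (∑ j, k j) + 3), TNorm α r f) := by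
  set P : ℝ := ∏ j, ((k j).factorial * 2 ^ (k j + 1) : ℝ)
  have hP : 0 ≤ P := by positivity
  refine ⟨12 * P, by positivity, fun f F hf hF => ⟨?_, ?_⟩⟩
  · obtain ⟨Ω, mΩ, ν, a, ha, -⟩ := exists_isBoxRep hα₂ hβ hsum k hf hF zero_lt_one le_rfl
    exact ⟨Ω, mΩ, ν, a, ha⟩
  · have hlim : Filter.Tendsto (fun δ : ℝ => ENNReal.ofReal (P *
        (4 * (3 * ∑ r ∈ Finset.range (n + (∑ j, k j) + 3), TNorm α r f + 6 * δ))))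
        (nhdsWithin 0 (Set.Ioi 0)) (nhds (ENNReal.ofReal
          (12 * P * ∑ r ∈ Finset.range (n + (∑ j, k j) + 3), TNorm α r f))) := by
      have hc : Continuous fun δ : ℝ => ENNReal.ofReal (P *
          (4 * (3 * ∑ r ∈ Finset.range (n + (∑ j, k j) + 3), TNorm α r f + 6 * δ))) :=
        ENNReal.continuous_ofReal.comp (by fun_prop)
      convert (hc.tendsto 0).mono_left nhdsWithin_le_nhds using 3
      ring
    refine ge_of_tendsto hlim ?_
    filter_upwards [Ioc_mem_nhdsGT (zero_lt_one (α := ℝ))] with δ hδ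
    obtain ⟨Ω, mΩ, ν, a, ha, hle⟩ := exists_isBoxRep hα₂ hβ hsum k hf hF hδ.1 hδ.2
    refine le_trans (sInf_le ?_) hle
    exact ⟨Ω, mΩ, ν, a, ha, rfl⟩
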